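/- arXiv:2305.20008 — 3 statements merged into one kernel-verified Lean document; each statement's English description precedes it below -/
import Mathlib

section
/- Let q be a prime power and n a positive integer. The number of rational functions of degree n in F_q(X) equals q^{2n-1}(q^2 - 1). -/
open Polynomial

/-- The degree of a rational function `f = P/Q` (with `P, Q` coprime) is
`max (deg P) (deg Q)`. -/
noncomputable def ratDeg {F : Type*} [Field F] (f : RatFunc F) : ℕ :=
  max f.num.natDegree f.denom.natDegree

theorem natCard_degreeLT (F : Type*) [Field F] (N : ℕ) :
    Nat.card (degreeLT F N) = Nat.card F ^ N := by
  rw [Nat.card_congr (degreeLTEquiv F N).toEquiv, Nat.card_fun, Nat.card_fin]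

instance finite_degreeLT (F : Type*) [Field F] [Finite F] (N : ℕ) : Finite (degreeLT F N) :=
  Finite.of_equiv _ (degreeLTEquiv F N).toEquiv.symm

theorem natCard_degreeLT_ne_zero (F : Type*) [Field F] [Finite F] (N : ℕ) :
    Nat.card {g : degreeLT F N // g ≠ 0} = Nat.card F ^ N - 1 := by
  classical
  have := Fintype.ofFinite (degreeLT F N)
  rw [Nat.card_eq_fintype_card, Fintype.card_subtype_compl, Fintype.card_subtype_eq,
    ← Nat.card_eq_fintype_card, natCard_degreeLT]

theorem mem_degreeLT_iff_natDegree_lt {F : Type*} [Field F] {N : ℕ} {p : F[X]} (hp : p ≠ 0) :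
    p ∈ degreeLT F N ↔ p.natDegree < N := by
  rw [mem_degreeLT, natDegree_lt_iff_degree_lt hp]

theorem mul_num_mem_and_mul_denom_mem_iff {F : Type*} [Field F] (N : ℕ) (f : RatFunc F)
    {g : F[X]} (hg : g ≠ 0) :
    g * f.num ∈ degreeLT F N ∧ g * f.denom ∈ degreeLT F N ↔
      g ∈ degreeLT F (N - ratDeg f) := by
  have hd := f.denom_ne_zero
  rw [mem_degreeLT_iff_natDegree_lt (mul_ne_zero hg hd), natDegree_mul hg hd,
    mem_degreeLT_iff_natDegree_lt hg, ratDeg]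
  by_cases hn : f.num = 0
  · simp only [hn, mul_zero, zero_mem, natDegree_zero, true_and]
    omega
  · rw [mem_degreeLT_iff_natDegree_lt (mul_ne_zero hg hn), natDegree_mul hg hn]
    omega

instance finite_ratDeg_le (F : Type*) [Field F] [Finite F] (m : ℕ) :
    Finite {f : RatFunc F // ratDeg f ≤ m} := by
  have h (f : {f : RatFunc F // ratDeg f ≤ m}) :
      f.1.num ∈ degreeLT F (m + 1) ∧ f.1.denom ∈ degreeLT F (m + 1) := by
    have h1 := (mul_num_mem_and_mul_denom_mem_iff (m + 1) f.1 one_ne_zero).2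
    rw [one_mul, one_mul, mem_degreeLT_iff_natDegree_lt one_ne_zero, natDegree_one] at h1
    exact h1 (by have := f.2; omega)
  refine Finite.of_injective
    (fun f => ((⟨_, (h f).1⟩, ⟨_, (h f).2⟩) : degreeLT F (m + 1) × degreeLT F (m + 1))) ?_
  intro f f' hff
  simp only [Prod.mk.injEq, Subtype.mk.injEq] at hff
  rw [Subtype.ext_iff, ← RatFunc.num_div_denom f.1, ← RatFunc.num_div_denom f'.1, hff.1, hff.2]

/-- Every fraction `P / Q` with `P`, `Q` of degree less than `N` and `Q ≠ 0` is obtained in exactly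
one way by expanding a reduced fraction by a nonzero polynomial. -/
theorem natCard_sigma_ratDeg_le (F : Type*) [Field F] {N m : ℕ} (hN : N ≤ m + 1) :
    Nat.card (Σ f : {f : RatFunc F // ratDeg f ≤ m},
        {g : degreeLT F (N - ratDeg f.1) // g ≠ 0}) =
      Nat.card (degreeLT F N × {Q : degreeLT F N // Q ≠ 0}) := by
  have h0 {k : ℕ} (g : {g : degreeLT F k // g ≠ 0}) : (g.1 : F[X]) ≠ 0 :=
    fun h => g.2 (Subtype.ext h)
  have hmem (x : Σ f : {f : RatFunc F // ratDeg f ≤ m},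
      {g : degreeLT F (N - ratDeg f.1) // g ≠ 0}) :=
    (mul_num_mem_and_mul_denom_mem_iff N x.1.1 (h0 x.2)).2 x.2.1.2
  refine Nat.card_eq_of_bijective (fun x => (⟨_, (hmem x).1⟩, ⟨⟨_, (hmem x).2⟩, fun h =>
    mul_ne_zero (h0 x.2) x.1.1.denom_ne_zero (congrArg Subtype.val h)⟩)) ⟨?_, ?_⟩
  · rintro ⟨⟨f, hf⟩, g⟩ ⟨⟨f', hf'⟩, g'⟩ h
    simp only [Prod.mk.injEq, Subtype.mk.injEq] at h
    obtain ⟨h1, h2⟩ := h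
    have hfrac (f : RatFunc F) {g : F[X]} (hg : g ≠ 0) : f =
        algebraMap F[X] (RatFunc F) (g * f.num) / algebraMap F[X] (RatFunc F) (g * f.denom) := by
      rw [map_mul, map_mul, mul_div_mul_left _ _ (RatFunc.algebraMap_ne_zero hg),
        RatFunc.num_div_denom]
    have hff : f = f' := by
      rw [hfrac f (h0 g), h1, h2, ← hfrac f' (h0 g')]
    subst hff
    have hgg : g = g' :=
      Subtype.ext (Subtype.ext (mul_right_cancel₀ f.denom_ne_zero h2))
    rw [hgg]
  · rintro ⟨⟨P, hP⟩, ⟨⟨Q, hQ⟩, hQ0⟩⟩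
    replace hQ0 : Q ≠ 0 := fun h => hQ0 (Subtype.ext h)
    set f : RatFunc F := algebraMap F[X] (RatFunc F) P / algebraMap F[X] (RatFunc F) Q with hf
    obtain ⟨g, hg⟩ := RatFunc.denom_div_dvd P Q
    rw [← hf, mul_comm] at hg
    have hg0 : g ≠ 0 := by rintro rfl; exact hQ0 (by rw [hg, zero_mul])
    have hPg : P = g * f.num := by
      have := (RatFunc.num_mul_eq_mul_denom_iff (x := f) hQ0).2 hf
      refine mul_right_cancel₀ f.denom_ne_zero ?_
      rw [← this]
      nth_rewrite 1 [hg]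
      ring
    have hgm : g ∈ degreeLT F (N - ratDeg f) := by
      rw [← mul_num_mem_and_mul_denom_mem_iff N f hg0, ← hPg, ← hg]
      exact ⟨hP, hQ⟩
    have hle : ratDeg f ≤ m := by
      have := (mem_degreeLT_iff_natDegree_lt hg0).1 hgm
      omega
    refine ⟨⟨⟨f, hle⟩, ⟨⟨g, hgm⟩, fun h => hg0 (congrArg Subtype.val h)⟩⟩, ?_⟩
    simp only [Prod.mk.injEq, Subtype.mk.injEq]
    exact ⟨hPg.symm, hg.symm⟩

theorem natCard_ratDeg_le (F : Type*) [Field F] [Finite F] (m : ℕ) :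
    Nat.card {f : RatFunc F // ratDeg f ≤ m} = Nat.card F ^ (2 * m + 1) := by
  have := Fintype.ofFinite {f : RatFunc F // ratDeg f ≤ m}
  have hq : 1 < Nat.card F := Finite.one_lt_card
  have key (N : ℕ) (hN : N ≤ m + 1) :
      ∑ f : {f : RatFunc F // ratDeg f ≤ m}, ((Nat.card F : ℤ) ^ (N - ratDeg f.1) - 1) =
        (Nat.card F : ℤ) ^ N * ((Nat.card F : ℤ) ^ N - 1) := by
    have h := natCard_sigma_ratDeg_le F hN
    rw [Nat.card_sigma, Nat.card_prod, natCard_degreeLT, natCard_degreeLT_ne_zero] at h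
    simp only [natCard_degreeLT_ne_zero] at h
    have hc (k : ℕ) : ((Nat.card F ^ k - 1 : ℕ) : ℤ) = (Nat.card F : ℤ) ^ k - 1 := by
      rw [Nat.cast_sub (Nat.one_le_pow _ _ (by omega))]
      push_cast
      rfl
    have h' := congrArg (Nat.cast : ℕ → ℤ) h
    rw [Nat.cast_sum, Nat.cast_mul, hc, Nat.cast_pow] at h'
    simpa only [hc] using h'
  have hsum : ∑ f : {f : RatFunc F // ratDeg f ≤ m}, ((Nat.card F : ℤ) - 1) =
      ∑ f : {f : RatFunc F // ratDeg f ≤ m}, ((Nat.card F : ℤ) ^ (m + 1 - ratDeg f.1) - 1) -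
        Nat.card F *
          ∑ f : {f : RatFunc F // ratDeg f ≤ m}, ((Nat.card F : ℤ) ^ (m - ratDeg f.1) - 1) := by
    rw [Finset.mul_sum, ← Finset.sum_sub_distrib]
    refine Finset.sum_congr rfl fun f _ => ?_
    rw [Nat.sub_add_comm f.2]
    ring
  rw [key _ le_rfl, key _ (Nat.le_succ m), Finset.sum_const, Finset.card_univ, nsmul_eq_mul,
    ← Nat.card_eq_fintype_card] at hsum
  have hq' : (Nat.card F : ℤ) - 1 ≠ 0 := by omega
  have : (Nat.card {f : RatFunc F // ratDeg f ≤ m} : ℤ) = (Nat.card F : ℤ) ^ (2 * m + 1) := by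
    refine mul_right_cancel₀ hq' ?_
    rw [hsum]
    ring
  exact_mod_cast this

/-- The number of rational functions of degree `n ≥ 1` in `F_q(X)` is
`q^(2n-1) * (q^2 - 1)`. -/
theorem count_ratFunc_of_degree (q n : ℕ) (hq : IsPrimePow q) (hn : 1 ≤ n)
    (F : Type*) [Field F] [Fintype F] (hF : Fintype.card F = q) :
    Nat.card {f : RatFunc F // ratDeg f = n} = q ^ (2 * n - 1) * (q ^ 2 - 1) := by
  obtain ⟨m, rfl⟩ := Nat.exists_eq_add_of_le' hn
  have hfin (k : ℕ) : {f : RatFunc F | ratDeg f ≤ k}.Finite := finite_ratDeg_le F k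
  have hdiff : {f : RatFunc F | ratDeg f = m + 1} =
      {f | ratDeg f ≤ m + 1} \ {f | ratDeg f ≤ m} := by
    ext f
    simp only [Set.mem_sdiff, Set.mem_ofPred_eq]
    omega
  have hcard (k : ℕ) : {f : RatFunc F | ratDeg f ≤ k}.ncard = q ^ (2 * k + 1) := by
    rw [← hF, ← Nat.card_eq_fintype_card]
    exact natCard_ratDeg_le F k
  change {f : RatFunc F | ratDeg f = m + 1}.ncard = _
  have hsub : {f : RatFunc F | ratDeg f ≤ m} ⊆ {f | ratDeg f ≤ m + 1} :=
    fun f (hf : ratDeg f ≤ m) => Nat.le_succ_of_le hf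
  rw [hdiff, Set.ncard_sdiff hsub (hfin m),
    hcard, hcard, Nat.mul_sub, mul_one, ← pow_add]
  congr 2
end

section
/- Let q be a prime power and n a positive integer. The number of fields F with F_q ⊆ F ⊆ F_q(X) and [F_q(X) : F] = n equals q^{2(n-1)}. -/
open Polynomial

namespace RatFunc

variable {K : Type*} [Field K]

/-- The height of a rational function: the larger of the degrees of its reduced numerator and
denominator. -/
noncomputable def height (f : RatFunc K) : ℕ :=
  max f.num.natDegree f.denom.natDegree

/-- A pair `(a, b)` with `b ≠ 0` is the same as a rational function `a / b` together with the
nonzero cofactor by which `(a, b)` differs from the reduced numerator and denominator. -/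
noncomputable def pairEquiv :
    K[X] × {b : K[X] // b ≠ 0} ≃ RatFunc K × {d : K[X] // d ≠ 0} where
  toFun x :=
    (algebraMap _ _ x.1 / algebraMap _ _ x.2.1,
      ⟨x.2.1 / (algebraMap _ _ x.1 / algebraMap _ _ x.2.1 : RatFunc K).denom, by
        intro h
        have h0 := (algebraMap _ _ x.1 / algebraMap _ _ x.2.1 : RatFunc K).denom_ne_zero
        apply x.2.2
        rw [← EuclideanDomain.mul_div_cancel' h0 (denom_div_dvd x.1 x.2.1), h, mul_zero]⟩)
  invFun y := (y.2.1 * y.1.num, ⟨y.2.1 * y.1.denom, mul_ne_zero y.2.2 y.1.denom_ne_zero⟩)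
  left_inv := by
    rintro ⟨a, b, hb⟩
    have h0 := (algebraMap _ _ a / algebraMap _ _ b : RatFunc K).denom_ne_zero
    have hd : b / (algebraMap _ _ a / algebraMap _ _ b : RatFunc K).denom *
        (algebraMap _ _ a / algebraMap _ _ b : RatFunc K).denom = b := by
      rw [mul_comm]
      exact EuclideanDomain.mul_div_cancel' h0 (denom_div_dvd a b)
    refine Prod.ext ?_ (Subtype.ext hd)
    have h := (num_mul_eq_mul_denom_iff (x := (algebraMap _ _ a / algebraMap _ _ b : RatFunc K))
      (p := a) hb).2 rfl
    apply mul_right_cancel₀ h0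
    dsimp only
    rw [← h, mul_right_comm, hd, mul_comm]
  right_inv := by
    rintro ⟨f, d, hd⟩
    have hf : (algebraMap _ _ (d * f.num) / algebraMap _ _ (d * f.denom) : RatFunc K) = f := by
      rw [map_mul, map_mul, mul_div_mul_left _ _ (algebraMap_ne_zero hd), num_div_denom]
    refine Prod.ext hf (Subtype.ext ?_)
    dsimp only
    rw [hf, mul_div_cancel_right₀ _ f.denom_ne_zero]

theorem degree_mul_num_lt_and_degree_mul_denom_lt_iff (f : RatFunc K) {d : K[X]} (hd : d ≠ 0)
    (M : ℕ) :
    (d * f.num).degree < M ∧ (d * f.denom).degree < M ↔ d.degree < (M - f.height : ℕ) := by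
  have hden : (d * f.denom).degree < M ↔ d.natDegree + f.denom.natDegree < M := by
    rw [degree_eq_natDegree (mul_ne_zero hd f.denom_ne_zero), natDegree_mul hd f.denom_ne_zero,
      Nat.cast_lt]
  rw [hden, degree_eq_natDegree hd, Nat.cast_lt, height]
  rcases eq_or_ne f 0 with rfl | hf
  · simp
  · rw [degree_eq_natDegree (mul_ne_zero hd (num_ne_zero hf)), natDegree_mul hd (num_ne_zero hf),
      Nat.cast_lt]
    omega

theorem card_degree_lt (M : ℕ) : Nat.card {p : K[X] // p.degree < M} = Nat.card K ^ M := by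
  have e : {p : K[X] // p.degree < M} ≃ degreeLT K M :=
    Equiv.subtypeEquivRight fun p => mem_degreeLT.symm
  rw [Nat.card_congr (e.trans (degreeLTEquiv K M).toEquiv), Nat.card_fun]
  simp

section Finite

variable [Finite K]

instance finite_degreeLT (M : ℕ) : Finite (degreeLT K M) :=
  Finite.of_equiv _ (degreeLTEquiv K M).toEquiv.symm

instance finite_degree_lt (M : ℕ) : Finite {p : K[X] // p.degree < M} :=
  Finite.of_equiv (degreeLT K M) (Equiv.subtypeEquivRight fun _ => mem_degreeLT)

theorem card_ne_zero_degree_lt (M : ℕ) :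
    Nat.card {d : {d : K[X] // d ≠ 0} // d.1.degree < M} = Nat.card K ^ M - 1 := by
  have e : {d : {d : K[X] // d ≠ 0} // d.1.degree < M} ≃
      {p : {p : K[X] // p.degree < M} // p ≠ ⟨0, by simp⟩} :=
    { toFun := fun d => ⟨⟨d.1.1, d.2⟩, fun h => d.1.2 (congrArg Subtype.val h)⟩
      invFun := fun p => ⟨⟨p.1.1, fun h => p.2 (Subtype.ext h)⟩, p.1.2⟩
      left_inv := fun _ => rfl
      right_inv := fun _ => rfl }
  classical
  have := Fintype.ofFinite {p : K[X] // p.degree < M}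
  rw [Nat.card_congr e, Nat.card_eq_fintype_card, Fintype.card_subtype_compl,
    Fintype.card_subtype_eq, ← Nat.card_eq_fintype_card, card_degree_lt]

instance finite_height_le (N : ℕ) : Finite {f : RatFunc K // f.height ≤ N} := by
  have key : ∀ p : K[X], p.natDegree ≤ N → p.degree < (N + 1 : ℕ) := fun p hp =>
    lt_of_le_of_lt (degree_le_of_natDegree_le hp) (by exact_mod_cast Nat.lt_succ_self N)
  refine Finite.of_injective
    (β := {p : K[X] // p.degree < (N + 1 : ℕ)} × {p : K[X] // p.degree < (N + 1 : ℕ)})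
    (fun f => (⟨f.1.num, key _ ((le_max_left _ _).trans f.2)⟩,
      ⟨f.1.denom, key _ ((le_max_right _ _).trans f.2)⟩)) ?_
  intro f g h
  simp only [Prod.mk.injEq, Subtype.mk.injEq] at h
  apply Subtype.ext
  rw [← num_div_denom f.1, ← num_div_denom g.1, h.1, h.2]

/-- Counting pairs of polynomials of degree less than `M` by the rational function they define. -/
theorem sum_height_le {M N : ℕ} (hMN : M ≤ N + 1) [Fintype {f : RatFunc K // f.height ≤ N}] :
    ∑ f : {f : RatFunc K // f.height ≤ N}, (Nat.card K ^ (M - f.1.height) - 1) =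
      Nat.card K ^ M * (Nat.card K ^ M - 1) := by
  have e₁ : {p : K[X] // p.degree < M} × {d : {d : K[X] // d ≠ 0} // d.1.degree < M} ≃
      {x : K[X] × {b : K[X] // b ≠ 0} // x.1.degree < M ∧ x.2.1.degree < M} :=
    { toFun := fun x => ⟨(x.1.1, x.2.1), x.1.2, x.2.2⟩
      invFun := fun x => (⟨x.1.1, x.2.1⟩, ⟨x.1.2, x.2.2⟩)
      left_inv := fun _ => rfl
      right_inv := fun _ => rfl }
  have e₂ : {x : K[X] × {b : K[X] // b ≠ 0} // x.1.degree < M ∧ x.2.1.degree < M} ≃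
      {y : RatFunc K × {d : K[X] // d ≠ 0} // y.2.1.degree < (M - y.1.height : ℕ)} :=
    (pairEquiv.symm.subtypeEquiv fun y =>
      (degree_mul_num_lt_and_degree_mul_denom_lt_iff y.1 y.2.2 M).symm).symm
  have e₃ : {y : RatFunc K × {d : K[X] // d ≠ 0} // y.2.1.degree < (M - y.1.height : ℕ)} ≃
      Σ f : {f : RatFunc K // f.height ≤ N},
        {d : {d : K[X] // d ≠ 0} // d.1.degree < (M - f.1.height : ℕ)} :=
    { toFun := fun y => ⟨⟨y.1.1, by
        have h := y.2
        rw [degree_eq_natDegree y.1.2.2, Nat.cast_lt] at h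
        omega⟩, y.1.2, y.2⟩
      invFun := fun z => ⟨(z.1.1, z.2.1), z.2.2⟩
      left_inv := fun _ => rfl
      right_inv := fun _ => rfl }
  have hfin (k : ℕ) : Finite {d : {d : K[X] // d ≠ 0} // d.1.degree < k} :=
    Finite.of_injective (β := {p : K[X] // p.degree < k}) (fun d => ⟨d.1.1, d.2⟩)
      fun a b h => Subtype.ext (Subtype.ext (Subtype.mk.inj h))
  have h := Nat.card_congr ((e₁.trans e₂).trans e₃)
  rw [Nat.card_prod, card_degree_lt, card_ne_zero_degree_lt, Nat.card_sigma] at h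
  simp only [card_ne_zero_degree_lt] at h
  exact h.symm

theorem card_height_le (N : ℕ) :
    Nat.card {f : RatFunc K // f.height ≤ N} = Nat.card K ^ (2 * N + 1) := by
  have := Fintype.ofFinite {f : RatFunc K // f.height ≤ N}
  have hq : 1 < Nat.card K := Finite.one_lt_card
  have hpow (k : ℕ) : 1 ≤ Nat.card K ^ k := Nat.one_le_pow _ _ (by omega)
  have h₁ := sum_height_le (K := K) (M := N + 1) (N := N) le_rfl
  have h₀ := sum_height_le (K := K) (M := N) (N := N) (Nat.le_succ N)
  rw [Nat.card_eq_fintype_card (α := {f : RatFunc K // f.height ≤ N})]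
  generalize Nat.card K = q at *
  zify [hpow] at h₀ h₁ ⊢
  have hq' : (q : ℤ) - 1 ≠ 0 := by
    have : (1 : ℤ) < q := by exact_mod_cast hq
    omega
  apply mul_right_cancel₀ hq'
  have key : ∀ f : {f : RatFunc K // f.height ≤ N},
      ((q : ℤ) ^ (N + 1 - f.1.height) - 1) - q * ((q : ℤ) ^ (N - f.1.height) - 1) = q - 1 := by
    intro f
    rw [Nat.succ_sub f.2, pow_succ]
    ring
  have hsum := Finset.sum_congr (rfl : (Finset.univ : Finset {f : RatFunc K // f.height ≤ N}) = _)
    fun f _ => key f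
  rw [Finset.sum_sub_distrib, ← Finset.mul_sum, h₀, h₁, Finset.sum_const, Finset.card_univ,
    nsmul_eq_mul] at hsum
  rw [← hsum]
  ring

theorem card_height_eq {n : ℕ} (hn : 1 ≤ n) :
    Nat.card {f : RatFunc K // f.height = n} =
      Nat.card K ^ (2 * (n - 1)) * (Nat.card K ^ 3 - Nat.card K) := by
  obtain ⟨m, rfl⟩ := Nat.exists_eq_add_of_le' hn
  have hfin : Finite {f : RatFunc K // f.height = m + 1} :=
    Finite.of_injective (β := {f : RatFunc K // f.height ≤ m + 1}) (fun f => ⟨f.1, f.2.le⟩)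
      fun a b h => Subtype.ext (Subtype.mk.inj h)
  classical
  have e : {f : RatFunc K // f.height ≤ m + 1} ≃
      {f : RatFunc K // f.height ≤ m} ⊕ {f : RatFunc K // f.height = m + 1} :=
    (Equiv.subtypeEquivRight fun f => Nat.le_succ_iff).trans
      (subtypeOrEquiv _ _ (Pi.disjoint_iff.2 fun f => by
        rw [Prop.disjoint_iff]; omega))
  have h := Nat.card_congr e
  rw [Nat.card_sum, card_height_le, card_height_le] at h
  have h' : Nat.card {f : RatFunc K // f.height = m + 1} =
      Nat.card K ^ (2 * (m + 1) + 1) - Nat.card K ^ (2 * m + 1) := by omega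
  rw [h', Nat.add_sub_cancel, Nat.mul_sub, ← pow_add, ← pow_succ]
  rfl

end Finite

open _root_.IntermediateField

/-- For a nontrivial intermediate field, its generators correspond to those of `K(X)`. -/
noncomputable def generatorsEquiv {E : IntermediateField K (RatFunc K)} (hE : E ≠ ⊥) :
    {u : RatFunc K // K⟮u⟯ = ⊤} ≃ {f : RatFunc K // K⟮f⟯ = E} :=
  have h (u : RatFunc K) : K⟮u⟯ = ⊤ ↔ K⟮(Luroth.algEquiv hE u : RatFunc K)⟯ = E := by
    let φ : RatFunc K →ₐ[K] RatFunc K := E.val.comp (Luroth.algEquiv hE).toAlgHom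
    have hφ : (⊤ : IntermediateField K (RatFunc K)).map φ = E := by
      ext x
      simp only [IntermediateField.mem_map, IntermediateField.mem_top, true_and]
      constructor
      · rintro ⟨y, rfl⟩
        exact (Luroth.algEquiv hE y).2
      · intro hx
        exact ⟨(Luroth.algEquiv hE).symm ⟨x, hx⟩, by simp [φ]⟩
    have hu : K⟮u⟯.map φ = K⟮(Luroth.algEquiv hE u : RatFunc K)⟯ := by
      rw [adjoin_map, Set.image_singleton]
      rfl
    rw [← hu, ← (IntermediateField.map_injective φ).eq_iff, hφ]
  { toFun u := ⟨Luroth.algEquiv hE u.1, (h u.1).1 u.2⟩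
    invFun f := ⟨(Luroth.algEquiv hE).symm ⟨f.1, by
        have := mem_adjoin_simple_self K f.1
        rwa [f.2] at this⟩, (h _).2 (by simpa using f.2)⟩
    left_inv u := by simp
    right_inv f := by simp }

theorem card_height_eq_card_finrank_mul {n : ℕ} (hn : 1 ≤ n) :
    Nat.card {f : RatFunc K // f.height = n} =
      Nat.card {E : IntermediateField K (RatFunc K) // Module.finrank E (RatFunc K) = n} *
        Nat.card {f : RatFunc K // f.height = 1} := by
  have hdeg (f : RatFunc K) : Module.finrank K⟮f⟯ (RatFunc K) = f.height :=
    f.finrank_eq_max_natDegree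
  have e₁ : {u : RatFunc K // K⟮u⟯ = ⊤} ≃ {f : RatFunc K // f.height = 1} :=
    Equiv.subtypeEquivRight fun u => by
      rw [← hdeg, IntermediateField.finrank_eq_one_iff_eq_top]
  have hbot {E : IntermediateField K (RatFunc K)} (h : Module.finrank E (RatFunc K) = n) :
      E ≠ ⊥ := by
    rintro rfl
    rw [← adjoin_zero (F := K) (E := RatFunc K), hdeg, height] at h
    simp only [num_zero, denom_zero, natDegree_zero, natDegree_one, max_self] at h
    omega
  have e₂ : {f : RatFunc K // f.height = n} ≃
      Σ E : {E : IntermediateField K (RatFunc K) // Module.finrank E (RatFunc K) = n},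
        {f : RatFunc K // K⟮f⟯ = E.1} :=
    { toFun := fun f => ⟨⟨K⟮f.1⟯, (hdeg f.1).trans f.2⟩, f.1, rfl⟩
      invFun := fun z => ⟨z.2.1, by rw [← hdeg, z.2.2, z.1.2]⟩
      left_inv := fun _ => rfl
      right_inv := by
        rintro ⟨⟨E, hE⟩, f, hf⟩
        dsimp only at hf
        subst hf
        rfl }
  rw [Nat.card_congr (e₂.trans ((Equiv.sigmaCongrRight fun E =>
    (generatorsEquiv (hbot E.2)).symm.trans e₁).trans (Equiv.sigmaEquivProd _ _))), Nat.card_prod]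

end RatFunc

/-- The number of intermediate fields `F_q ⊆ F ⊆ F_q(X)` with `[F_q(X) : F] = n`
is `q^(2(n-1))`. -/
theorem count_subfields_of_degree (q n : ℕ) (hq : IsPrimePow q) (hn : 1 ≤ n)
    (F : Type*) [Field F] [Fintype F] (hF : Fintype.card F = q) :
    Nat.card {E : IntermediateField F (RatFunc F) //
        Module.finrank E (RatFunc F) = n} = q ^ (2 * (n - 1)) := by
  have h := RatFunc.card_height_eq_card_finrank_mul (K := F) hn
  rw [RatFunc.card_height_eq hn, RatFunc.card_height_eq le_rfl, Nat.card_eq_fintype_card (α := F),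
    hF, Nat.sub_self, Nat.mul_zero, pow_zero, one_mul] at h
  have hpos : 0 < q ^ 3 - q := by
    have : q ^ 1 < q ^ 3 := Nat.pow_lt_pow_right hq.one_lt (by norm_num)
    rw [pow_one] at this
    omega
  exact (Nat.eq_of_mul_eq_mul_right hpos h).symm
end

section
/- Let q be a prime power, n ≥ 1, and let a, b ∈ F_q^* with a ≠ b, and let d be the multiplicative order of a/b in F_q^*. Let σ be the F_q-automorphism of F_q(X) with σ(X) = (a/b)·X. Then Fix(σ) = q^{2n/d - 2} + (d-1)(q^{2n/d} - 1)/(q+1) if d divides n, and Fix(σ) = (q^{2⌊n/d⌋+1} + 1)/(q+1) if d does not divide n. -/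
open Polynomial

/-- Monic polynomials of degree `m`. -/
def monics (F : Type*) [Field F] (m : ℕ) : Set F[X] :=
  {P | P.Monic ∧ P.natDegree = m}

/-- Coprime pairs consisting of a monic polynomial of degree `m` and a polynomial of degree
less than `k`. -/
def coprimePairs (F : Type*) [Field F] (m k : ℕ) : Set (F[X] × F[X]) :=
  {x | x.1 ∈ monics F m ∧ x.2 ∈ degreeLT F k ∧ IsCoprime x.1 x.2}

/-- Coprime pairs `(P, Q)` of monic polynomials with `P` of degree `n`, `Q` of smaller degree `e`,
and vanishing coefficient of `X ^ e` in `P`. The rational functions `P / Q` are a system of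
representatives for the generators of the subfields of codegree `n`. -/
def normalPairs (F : Type*) [Field F] (n : ℕ) : Set (F[X] × F[X]) :=
  {x ∈ coprimePairs F n n | x.2.Monic ∧ x.1.coeff x.2.natDegree = 0}

section Counting

variable {F : Type*} [Field F]

theorem mul_injOn_coprime {g g' P P' Q Q' : F[X]} (hg : g.Monic) (hg' : g'.Monic)
    (h : IsCoprime P Q) (h' : IsCoprime P' Q') (hP : g * P = g' * P') (hQ : g * Q = g' * Q') :
    g = g' ∧ P = P' ∧ Q = Q' := by
  have key : ∀ {g g' P P' Q Q' : F[X]}, IsCoprime P Q → g * P = g' * P' → g * Q = g' * Q' →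
      g' ∣ g := by
    rintro g g' P P' Q Q' ⟨u, v, h⟩ hP hQ
    refine ⟨u * P' + v * Q', ?_⟩
    linear_combination (-g) * h + u * hP + v * hQ
  obtain rfl : g = g' := eq_of_monic_of_associated hg hg'
    (associated_of_dvd_dvd (key h' hP.symm hQ.symm) (key h hP hQ))
  exact ⟨rfl, mul_left_cancel₀ hg.ne_zero hP, mul_left_cancel₀ hg.ne_zero hQ⟩

theorem monics_prod_degreeLT_eq_biUnion (m : ℕ) :
    monics F m ×ˢ (degreeLT F m : Set F[X]) =
      ⋃ k ∈ (Finset.range (m + 1) : Set ℕ), (fun x : F[X] × F[X] × F[X] =>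
        (x.1 * x.2.1, x.1 * x.2.2)) '' (monics F k ×ˢ coprimePairs F (m - k) (m - k)) := by
  classical
  ext ⟨P, Q⟩
  simp only [Set.mem_prod, Set.mem_iUnion, Set.mem_image, Prod.exists, Prod.mk.injEq,
    Finset.coe_range, Set.mem_Iio, SetLike.mem_coe]
  constructor
  · rintro ⟨⟨hP, rfl⟩, hQ⟩
    have hg0 : gcd P Q ≠ 0 := fun h => hP.ne_zero ((gcd_eq_zero_iff _ _).mp h).1
    have hg : (gcd P Q).Monic := by
      rw [← normalize_gcd]; exact monic_normalize hg0
    obtain ⟨P', hP'⟩ := gcd_dvd_left P Q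
    obtain ⟨Q', hQ'⟩ := gcd_dvd_right P Q
    have hP'm : P'.Monic := hg.of_mul_monic_left (hP' ▸ hP)
    have hdeg : P.natDegree = (gcd P Q).natDegree + P'.natDegree := by
      conv_lhs => rw [hP']
      exact hg.natDegree_mul hP'm
    refine ⟨(gcd P Q).natDegree, by omega, gcd P Q, P', Q', ⟨⟨hg, rfl⟩, ⟨hP'm, ?_⟩, ?_, ?_⟩,
      hP'.symm, hQ'.symm⟩
    · dsimp; omega
    · rw [mem_degreeLT] at hQ ⊢
      by_cases h0 : Q' = 0
      · simp [h0]
      have h1 : Q ≠ 0 := by rw [hQ']; exact mul_ne_zero hg0 h0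
      rw [degree_eq_natDegree h1, Nat.cast_lt] at hQ
      rw [degree_eq_natDegree h0, Nat.cast_lt]
      have : Q.natDegree = (gcd P Q).natDegree + Q'.natDegree := by
        conv_lhs => rw [hQ']
        exact natDegree_mul hg0 h0
      omega
    · obtain ⟨u, v, huv⟩ := exists_gcd_eq_mul_add_mul P Q
      refine ⟨u, v, mul_left_cancel₀ hg0 ?_⟩
      calc gcd P Q * (u * P' + v * Q') = (gcd P Q * P') * u + (gcd P Q * Q') * v := by ring
        _ = _ := by rw [← hP', ← hQ', ← huv, mul_one]
  · rintro ⟨k, hk, g, P, Q, ⟨⟨hg, rfl⟩, ⟨hP, hPd⟩, hQ, -⟩, rfl, rfl⟩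
    dsimp only at hP hPd hQ
    refine ⟨⟨hg.mul hP, ?_⟩, ?_⟩
    · rw [hg.natDegree_mul hP]; omega
    · rw [mem_degreeLT] at hQ ⊢
      by_cases h0 : Q = 0
      · simp [h0]
      rw [degree_eq_natDegree h0, Nat.cast_lt] at hQ
      rw [degree_eq_natDegree (mul_ne_zero hg.ne_zero h0), Nat.cast_lt,
        natDegree_mul hg.ne_zero h0]
      omega

theorem isCoprime_X_left_iff {Q : F[X]} : IsCoprime X Q ↔ Q.coeff 0 ≠ 0 := by
  rw [irreducible_X.coprime_iff_not_dvd, X_dvd_iff]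

theorem ncard_filter_add_ncard_filter_not {α : Type*} {s : Set α} (hs : s.Finite) (p : α → Prop) :
    {x ∈ s | p x}.ncard + {x ∈ s | ¬ p x}.ncard = s.ncard :=
  Set.ncard_inter_add_ncard_sdiff_eq_ncard s {x | p x} hs

theorem X_mul_mem_degreeLT_succ {m : ℕ} {Q : F[X]} :
    X * Q ∈ degreeLT F (m + 1) ↔ Q ∈ degreeLT F m := by
  by_cases h0 : Q = 0
  · simp [h0]
  · rw [mem_degreeLT, mem_degreeLT, degree_eq_natDegree h0,
      degree_eq_natDegree (mul_ne_zero X_ne_zero h0), natDegree_X_mul h0]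
    norm_cast
    omega

theorem X_mul_mem_monics_succ {m : ℕ} {P : F[X]} :
    X * P ∈ monics F (m + 1) ↔ P ∈ monics F m := by
  refine ⟨fun ⟨h, h'⟩ => ?_, fun ⟨h, h'⟩ => ⟨monic_X.mul h, ?_⟩⟩
  · have hP : P.Monic := monic_X.of_mul_monic_left h
    rw [natDegree_X_mul hP.ne_zero] at h'
    exact ⟨hP, by omega⟩
  · rw [natDegree_X_mul h.ne_zero, h']

theorem smul_mem_coprimePairs {m k : ℕ} {x : F[X] × F[X]} (hx : x ∈ coprimePairs F m k) {c : F}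
    (hc : c ≠ 0) : (x.1, C c * x.2) ∈ coprimePairs F m k := by
  obtain ⟨hP, hQ, h⟩ := hx
  refine ⟨hP, ?_, ?_⟩
  · dsimp only
    rw [← smul_eq_C_mul]
    exact (degreeLT F k).smul_mem c hQ
  · exact (isCoprime_mul_unit_left_right (isUnit_C.mpr hc.isUnit) _ _).mpr h

theorem snd_ne_zero_of_mem_coprimePairs {m k : ℕ} {x : F[X] × F[X]}
    (hx : x ∈ coprimePairs F (m + 1) k) : x.2 ≠ 0 := by
  intro h0
  obtain ⟨⟨-, hP⟩, -, h⟩ := hx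
  rw [h0, isCoprime_zero_right] at h
  have := natDegree_eq_zero_of_isUnit h
  omega

theorem monic_add_C_mul {n : ℕ} {P Q : F[X]} (hP : P ∈ monics F n) (hQ : Q ∈ degreeLT F n) (c : F) :
    P + C c * Q ∈ monics F n := by
  have hd : (C c * Q).degree < P.degree := by
    rw [degree_eq_natDegree hP.1.ne_zero, hP.2, ← mem_degreeLT, ← smul_eq_C_mul]
    exact (degreeLT F n).smul_mem c hQ
  exact ⟨hP.1.add_of_left hd, by rw [natDegree_add_eq_left_of_degree_lt hd, hP.2]⟩

theorem add_C_mul_mem_coprimePairs {n : ℕ} {x : F[X] × F[X]} (hx : x ∈ coprimePairs F n n) (c : F) :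
    (x.1 + C c * x.2, x.2) ∈ coprimePairs F n n :=
  ⟨monic_add_C_mul hx.1 hx.2.1 c, hx.2.1, by
    simpa [mul_comm] using hx.2.2.add_mul_left_left (C c)⟩

variable [Fintype F]

theorem finite_degreeLT_s2 (m : ℕ) : (degreeLT F m : Set F[X]).Finite :=
  (Finite.of_equiv _ (degreeLTEquiv F m).toEquiv.symm : Finite (degreeLT F m))

theorem ncard_degreeLT (m : ℕ) : (degreeLT F m : Set F[X]).ncard = Fintype.card F ^ m := by
  rw [← Nat.card_coe_set_eq]
  exact (Nat.card_congr (degreeLTEquiv F m).toEquiv).trans (by simp)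

theorem finite_monics (m : ℕ) : (monics F m).Finite :=
  have : Finite (degreeLT F m) := finite_degreeLT_s2 m
  Finite.of_equiv _ (monicEquivDegreeLT m).symm

theorem ncard_monics (m : ℕ) : (monics F m).ncard = Fintype.card F ^ m := by
  rw [← Nat.card_coe_set_eq, ← ncard_degreeLT, ← Nat.card_coe_set_eq]
  exact Nat.card_congr (monicEquivDegreeLT m)

theorem finite_coprimePairs (m k : ℕ) : (coprimePairs F m k).Finite :=
  ((finite_monics m).prod (finite_degreeLT_s2 k)).subset fun _ hx => ⟨hx.1, hx.2.1⟩

theorem sum_card_pow_mul_ncard_coprimePairs (m : ℕ) :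
    ∑ k ∈ Finset.range (m + 1), Fintype.card F ^ k * (coprimePairs F (m - k) (m - k)).ncard =
      Fintype.card F ^ (2 * m) := by
  have h := congrArg Set.ncard (monics_prod_degreeLT_eq_biUnion (F := F) m)
  rw [Set.ncard_prod, ncard_monics, ncard_degreeLT, Set.Finite.ncard_biUnion
    (Finset.finite_toSet _), finsum_mem_coe_finset] at h
  · rw [two_mul, pow_add, h]
    refine Finset.sum_congr rfl fun k _ => ?_
    rw [Set.InjOn.ncard_image, Set.ncard_prod, ncard_monics]
    rintro ⟨g, P, Q⟩ ⟨hg, -, -, h⟩ ⟨g', P', Q'⟩ ⟨hg', -, -, h'⟩ he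
    simp only [Prod.mk.injEq] at he ⊢
    exact mul_injOn_coprime hg.1 hg'.1 h h' he.1 he.2
  · exact fun k _ => ((finite_monics k).prod (finite_coprimePairs _ _)).image _
  · intro k _ k' _ hkk'
    rw [Function.onFun, Set.disjoint_left]
    rintro _ ⟨⟨g, P, Q⟩, ⟨hg, -, -, h⟩, rfl⟩ ⟨⟨g', P', Q'⟩, ⟨hg', -, -, h'⟩, he⟩
    simp only [Prod.mk.injEq] at he
    refine hkk' ?_
    rw [← hg.2, ← hg'.2, (mul_injOn_coprime hg'.1 hg.1 h' h he.1 he.2).1]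

theorem ncard_coprimePairs_zero : (coprimePairs F 0 0).ncard = 1 := by
  simpa using sum_card_pow_mul_ncard_coprimePairs (F := F) 0

theorem ncard_coprimePairs_succ (m : ℕ) :
    (coprimePairs F (m + 1) (m + 1)).ncard + Fintype.card F ^ (2 * m + 1) =
      Fintype.card F ^ (2 * m + 2) := by
  have h := sum_card_pow_mul_ncard_coprimePairs (F := F) (m + 1)
  rw [Finset.sum_range_succ'] at h
  simp only [pow_succ', mul_assoc, ← Finset.mul_sum, Nat.add_sub_add_right, mul_add,
    sum_card_pow_mul_ncard_coprimePairs] at h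
  rw [← pow_succ'] at h
  simp at h
  rw [add_comm, h]
  ring

theorem ncard_coprimePairs_succ_eq_add (m : ℕ) :
    (coprimePairs F (m + 1) (m + 1)).ncard =
      {x ∈ coprimePairs F m (m + 1) | x.2.coeff 0 ≠ 0}.ncard +
        {x ∈ coprimePairs F (m + 1) (m + 1) | x.1.coeff 0 ≠ 0}.ncard := by
  rw [← ncard_filter_add_ncard_filter_not (finite_coprimePairs _ _) fun x => x.1.coeff 0 = 0]
  congr 1
  have : {x ∈ coprimePairs F (m + 1) (m + 1) | x.1.coeff 0 = 0} =
      (fun x : F[X] × F[X] => (X * x.1, x.2)) ''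
        {x ∈ coprimePairs F m (m + 1) | x.2.coeff 0 ≠ 0} := by
    ext ⟨P, Q⟩
    constructor
    · rintro ⟨⟨hP, hQ, h⟩, h0⟩
      obtain ⟨P, rfl⟩ := X_dvd_iff.mpr h0
      rw [IsCoprime.mul_left_iff, isCoprime_X_left_iff] at h
      exact ⟨(P, Q), ⟨⟨X_mul_mem_monics_succ.mp hP, hQ, h.2⟩, h.1⟩, rfl⟩
    · rintro ⟨⟨P, Q⟩, ⟨⟨hP, hQ, h⟩, h0⟩, he⟩
      obtain ⟨rfl, rfl⟩ := Prod.mk.inj he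
      exact ⟨⟨X_mul_mem_monics_succ.mpr hP, hQ,
        IsCoprime.mul_left_iff.mpr ⟨isCoprime_X_left_iff.mpr h0, h⟩⟩, by simp⟩
  rw [this, Set.InjOn.ncard_image]
  rintro ⟨P, Q⟩ - ⟨P', Q'⟩ - he
  simpa [X_ne_zero] using he

theorem card_mul_ncard_coprimePairs (m : ℕ) :
    Fintype.card F * (coprimePairs F m m).ncard = (coprimePairs F m (m + 1)).ncard := by
  have : coprimePairs F m (m + 1) = (fun x : F × F[X] × F[X] => (x.2.1, x.2.2 + C x.1 * x.2.1)) ''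
      (Set.univ ×ˢ coprimePairs F m m) := by
    ext ⟨P, Q⟩
    constructor
    · rintro ⟨hP, hQ, h⟩
      dsimp only at hP hQ h
      refine ⟨(Q.coeff m, P, Q - C (Q.coeff m) * P), ⟨trivial, hP, ?_, ?_⟩, by simp⟩
      · dsimp only
        rw [mem_degreeLT, degree_lt_iff_coeff_zero] at hQ ⊢
        intro k hk
        rcases hk.eq_or_lt with rfl | hk
        · have := hP.1.coeff_natDegree
          rw [hP.2] at this
          simp [this]
        · rw [coeff_sub, hQ k hk, coeff_C_mul, coeff_eq_zero_of_natDegree_lt (hP.2.trans_lt hk)]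
          simp
      · simpa [sub_eq_add_neg, ← neg_mul, mul_comm] using h.add_mul_left_right (-C (Q.coeff m))
    · rintro ⟨⟨c, P, Q⟩, ⟨-, hP, hQ, h⟩, he⟩
      obtain ⟨rfl, rfl⟩ := Prod.mk.inj he
      dsimp only at hP hQ h
      refine ⟨hP, ?_, by simpa [mul_comm] using h.add_mul_left_right (C c)⟩
      dsimp only
      rw [mem_degreeLT, degree_lt_iff_coeff_zero] at hQ ⊢
      intro k hk
      rw [coeff_add, hQ k (by omega), coeff_C_mul,
        coeff_eq_zero_of_natDegree_lt (hP.2.trans_lt hk)]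
      simp
  rw [this, Set.InjOn.ncard_image, Set.ncard_prod, Set.ncard_univ, Nat.card_eq_fintype_card]
  rintro ⟨c, P, Q⟩ ⟨-, hP, hQ, -⟩ ⟨c', P', Q'⟩ ⟨-, -, hQ', -⟩ he
  dsimp only at hP hQ hQ'
  simp only [Prod.mk.injEq] at he ⊢
  obtain ⟨rfl, he⟩ := he
  rw [mem_degreeLT, degree_lt_iff_coeff_zero] at hQ hQ'
  have hc : c = c' := by
    have h1 := hP.1.coeff_natDegree
    rw [hP.2] at h1
    simpa [h1, hQ m le_rfl, hQ' m le_rfl] using congrArg (fun R => coeff R m) he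
  subst hc
  exact ⟨rfl, rfl, add_right_cancel he⟩

theorem card_mul_ncard_coprimePairs_eq_add (m : ℕ) :
    Fintype.card F * (coprimePairs F m m).ncard =
      {x ∈ coprimePairs F m m | x.1.coeff 0 ≠ 0}.ncard +
        {x ∈ coprimePairs F m (m + 1) | x.2.coeff 0 ≠ 0}.ncard := by
  rw [card_mul_ncard_coprimePairs,
    ← ncard_filter_add_ncard_filter_not (finite_coprimePairs _ _) fun x => x.2.coeff 0 = 0]
  congr 1
  have : {x ∈ coprimePairs F m (m + 1) | x.2.coeff 0 = 0} =
      (fun x : F[X] × F[X] => (x.1, X * x.2)) ''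
        {x ∈ coprimePairs F m m | x.1.coeff 0 ≠ 0} := by
    ext ⟨P, Q⟩
    constructor
    · rintro ⟨⟨hP, hQ, h⟩, h0⟩
      obtain ⟨Q, rfl⟩ := X_dvd_iff.mpr h0
      rw [IsCoprime.mul_right_iff, isCoprime_comm, isCoprime_X_left_iff] at h
      exact ⟨(P, Q), ⟨⟨hP, X_mul_mem_degreeLT_succ.mp hQ, h.2⟩, h.1⟩, rfl⟩
    · rintro ⟨⟨P, Q⟩, ⟨⟨hP, hQ, h⟩, h0⟩, he⟩
      obtain ⟨rfl, rfl⟩ := Prod.mk.inj he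
      exact ⟨⟨hP, X_mul_mem_degreeLT_succ.mpr hQ,
        IsCoprime.mul_right_iff.mpr ⟨(isCoprime_X_left_iff.mpr h0).symm, h⟩⟩, by simp⟩
  rw [this, Set.InjOn.ncard_image]
  rintro ⟨P, Q⟩ - ⟨P', Q'⟩ - he
  simpa [X_ne_zero] using he

theorem ncard_coprimePairs_coeff_zero_ne_zero (m : ℕ) :
    (((Fintype.card F : ℚ) + 1) * {x ∈ coprimePairs F (m + 1) (m + 1) | x.1.coeff 0 ≠ 0}.ncard =
      ((Fintype.card F : ℚ) - 1) * ((Fintype.card F : ℚ) ^ (2 * (m + 1)) - 1)) ∧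
    (((Fintype.card F : ℚ) + 1) * {x ∈ coprimePairs F m (m + 1) | x.2.coeff 0 ≠ 0}.ncard =
      ((Fintype.card F : ℚ) - 1) * ((Fintype.card F : ℚ) ^ (2 * m + 1) + 1)) := by
  have hN (m : ℕ) := ncard_coprimePairs_succ (F := F) m
  have h1 (m : ℕ) := ncard_coprimePairs_succ_eq_add (F := F) m
  have h2 (m : ℕ) := card_mul_ncard_coprimePairs_eq_add (F := F) m
  have h00 : {x ∈ coprimePairs F 0 0 | x.1.coeff 0 ≠ 0} = coprimePairs F 0 0 := by
    refine Set.sep_eq_self_iff_mem_true.mpr fun x hx => ?_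
    rw [eq_one_of_monic_natDegree_zero hx.1.1 hx.1.2]
    simp
  have h0 := h2 0
  rw [h00, ncard_coprimePairs_zero] at h0
  qify at hN h1 h2 h0
  have hQ : ((Fintype.card F : ℚ) + 1) * {x ∈ coprimePairs F m (m + 1) | x.2.coeff 0 ≠ 0}.ncard =
      ((Fintype.card F : ℚ) - 1) * ((Fintype.card F : ℚ) ^ (2 * m + 1) + 1) := by
    induction m with
    | zero => linear_combination (-(Fintype.card F : ℚ) - 1) * h0
    | succ m ih =>
      linear_combination ih + ((Fintype.card F : ℚ) + 1) *
        (h1 m - h2 (m + 1) + ((Fintype.card F : ℚ) - 1) * hN m)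
  refine ⟨?_, hQ⟩
  linear_combination ((Fintype.card F : ℚ) + 1) * (hN m - h1 m) - hQ


theorem card_sub_one_mul_ncard_monic_snd {S : Set (F[X] × F[X])} (h0 : ∀ x ∈ S, x.2 ≠ 0)
    (hS : ∀ x ∈ S, ∀ c : F, c ≠ 0 → (x.1, C c * x.2) ∈ S) :
    ((Fintype.card F : ℚ) - 1) * {x ∈ S | x.2.Monic}.ncard = S.ncard := by
  have : S = (fun x : Fˣ × F[X] × F[X] => (x.2.1, C (x.1 : F) * x.2.2)) ''
      (Set.univ ×ˢ {x ∈ S | x.2.Monic}) := by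
    ext ⟨P, Q⟩
    constructor
    · intro h
      have hc : Q.leadingCoeff ≠ 0 := leadingCoeff_ne_zero.mpr (h0 _ h)
      refine ⟨(Units.mk0 _ hc, P, C Q.leadingCoeff⁻¹ * Q), ⟨trivial, hS _ h _ (inv_ne_zero hc), ?_⟩,
        ?_⟩
      · rw [mul_comm]
        exact monic_mul_leadingCoeff_inv (h0 _ h)
      · simp [← mul_assoc, ← C_mul, hc]
    · rintro ⟨⟨c, P, Q⟩, ⟨-, h, -⟩, he⟩
      obtain ⟨rfl, rfl⟩ := Prod.mk.inj he
      exact hS _ h _ c.ne_zero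
  conv_rhs => rw [this]
  rw [Set.InjOn.ncard_image, Set.ncard_prod, Set.ncard_univ, Nat.card_units,
    Nat.card_eq_fintype_card, Nat.cast_mul, Nat.cast_sub Fintype.card_pos, Nat.cast_one]
  rintro ⟨c, P, Q⟩ ⟨-, -, hQ⟩ ⟨c', P', Q'⟩ ⟨-, -, hQ'⟩ he
  dsimp only at hQ hQ'
  simp only [Prod.mk.injEq] at he ⊢
  obtain ⟨rfl, he⟩ := he
  have hc : (c : F) = c' := by
    simpa [hQ.leadingCoeff, hQ'.leadingCoeff] using congrArg leadingCoeff he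
  rw [hc] at he
  exact ⟨Units.ext hc, rfl, mul_left_cancel₀ (C_ne_zero.mpr c'.ne_zero) he⟩

theorem ncard_coprimePairs_monic (m : ℕ) :
    (({x ∈ coprimePairs F (m + 1) (m + 1) | x.2.Monic}.ncard : ℚ)) =
      (Fintype.card F : ℚ) ^ (2 * m + 1) := by
  have h := card_sub_one_mul_ncard_monic_snd (S := coprimePairs F (m + 1) (m + 1))
    (fun x hx => snd_ne_zero_of_mem_coprimePairs hx) fun x hx c hc => smul_mem_coprimePairs hx hc
  have hN := ncard_coprimePairs_succ (F := F) m
  qify at hN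
  have hq : (Fintype.card F : ℚ) - 1 ≠ 0 :=
    sub_ne_zero.mpr (by exact_mod_cast Fintype.one_lt_card.ne')
  exact mul_left_cancel₀ hq (by linear_combination h + hN)

theorem ncard_coprimePairs_monic_fst_coeff_zero_ne_zero (m : ℕ) :
    ((Fintype.card F : ℚ) + 1) *
      {x ∈ coprimePairs F (m + 1) (m + 1) | x.1.coeff 0 ≠ 0 ∧ x.2.Monic}.ncard =
        (Fintype.card F : ℚ) ^ (2 * (m + 1)) - 1 := by
  have h := card_sub_one_mul_ncard_monic_snd
    (S := {x ∈ coprimePairs F (m + 1) (m + 1) | x.1.coeff 0 ≠ 0})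
    (fun x hx => snd_ne_zero_of_mem_coprimePairs hx.1)
    fun x hx c hc => ⟨smul_mem_coprimePairs hx.1 hc, hx.2⟩
  have hN := (ncard_coprimePairs_coeff_zero_ne_zero (F := F) m).1
  have hq : (Fintype.card F : ℚ) - 1 ≠ 0 :=
    sub_ne_zero.mpr (by exact_mod_cast Fintype.one_lt_card.ne')
  simp only [Set.mem_ofPred_eq, and_assoc] at h
  exact mul_left_cancel₀ hq (by linear_combination ((Fintype.card F : ℚ) + 1) * h + hN)

theorem ncard_coprimePairs_monic_snd_coeff_zero_ne_zero (m : ℕ) :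
    ((Fintype.card F : ℚ) + 1) *
      {x ∈ coprimePairs F m (m + 1) | x.2.coeff 0 ≠ 0 ∧ x.2.Monic}.ncard =
        (Fintype.card F : ℚ) ^ (2 * m + 1) + 1 := by
  have h := card_sub_one_mul_ncard_monic_snd
    (S := {x ∈ coprimePairs F m (m + 1) | x.2.coeff 0 ≠ 0})
    (fun x hx h0 => hx.2 (by simp [h0]))
    fun x hx c hc => ⟨smul_mem_coprimePairs hx.1 hc, by simpa [hc] using hx.2⟩
  have hN := (ncard_coprimePairs_coeff_zero_ne_zero (F := F) m).2
  have hq : (Fintype.card F : ℚ) - 1 ≠ 0 :=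
    sub_ne_zero.mpr (by exact_mod_cast Fintype.one_lt_card.ne')
  simp only [Set.mem_ofPred_eq, and_assoc] at h
  exact mul_left_cancel₀ hq (by linear_combination ((Fintype.card F : ℚ) + 1) * h + hN)

theorem ncard_normalPairs_succ (m : ℕ) :
    ((normalPairs F (m + 1)).ncard : ℚ) = (Fintype.card F : ℚ) ^ (2 * m) := by
  have : {x ∈ coprimePairs F (m + 1) (m + 1) | x.2.Monic} =
      (fun x : F × F[X] × F[X] => (x.2.1 + C x.1 * x.2.2, x.2.2)) ''
        (Set.univ ×ˢ normalPairs F (m + 1)) := by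
    ext ⟨P, Q⟩
    constructor
    · rintro ⟨h, hQ⟩
      refine ⟨(P.coeff Q.natDegree, P + C (-P.coeff Q.natDegree) * Q, Q),
        ⟨trivial, add_C_mul_mem_coprimePairs h _, hQ, ?_⟩, by simp⟩
      have := hQ.coeff_natDegree
      dsimp only at this ⊢
      simp [this]
    · rintro ⟨⟨c, P, Q⟩, ⟨-, h, hQ, -⟩, he⟩
      obtain ⟨rfl, rfl⟩ := Prod.mk.inj he
      exact ⟨add_C_mul_mem_coprimePairs h c, hQ⟩
  have h := ncard_coprimePairs_monic (F := F) m
  rw [this, Set.InjOn.ncard_image, Set.ncard_prod, Set.ncard_univ, Nat.card_eq_fintype_card,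
    pow_succ', Nat.cast_mul] at h
  · exact mul_left_cancel₀ (by exact_mod_cast Fintype.card_ne_zero) h
  rintro ⟨c, P, Q⟩ ⟨-, -, hQ, h0⟩ ⟨c', P', Q'⟩ ⟨-, -, -, h0'⟩ he
  dsimp only at hQ h0 h0'
  simp only [Prod.mk.injEq] at he ⊢
  obtain ⟨he, rfl⟩ := he
  obtain rfl : c = c' := by
    simpa [h0, h0', hQ.coeff_natDegree] using congrArg (fun R => coeff R Q.natDegree) he
  exact ⟨rfl, add_right_cancel he, rfl⟩

end Counting

section Subfields

variable {F : Type*} [Field F]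

/-- The subfield of `F(X)` generated by the quotient of a pair of polynomials. -/
noncomputable def quotientField (x : F[X] × F[X]) : IntermediateField F (RatFunc F) :=
  IntermediateField.adjoin F {algebraMap F[X] (RatFunc F) x.1 / algebraMap F[X] (RatFunc F) x.2}

theorem num_denom_of_isCoprime {P Q : F[X]} (hQ : Q.Monic) (h : IsCoprime P Q) :
    (algebraMap F[X] (RatFunc F) P / algebraMap F[X] (RatFunc F) Q).num = P ∧
      (algebraMap F[X] (RatFunc F) P / algebraMap F[X] (RatFunc F) Q).denom = Q := by
  set f := algebraMap F[X] (RatFunc F) P / algebraMap F[X] (RatFunc F) Q with hf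
  have he : f.num * Q = P * f.denom := (RatFunc.num_mul_eq_mul_denom_iff hQ.ne_zero).mpr hf
  have hd : f.denom = Q := eq_of_monic_of_associated f.monic_denom hQ <| associated_of_dvd_dvd
    (f.isCoprime_num_denom.symm.dvd_of_dvd_mul_left ⟨P, by rw [he, mul_comm]⟩)
    (h.symm.dvd_of_dvd_mul_left ⟨f.num, by rw [← he, mul_comm]⟩)
  rw [hd] at he
  exact ⟨mul_right_cancel₀ hQ.ne_zero he, hd⟩

theorem moebius_mem_quotientField {P Q : F[X]} (hQ : Q ≠ 0) (α β γ δ : F) :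
    algebraMap F[X] (RatFunc F) (C α * P + C β * Q) /
      algebraMap F[X] (RatFunc F) (C γ * P + C δ * Q) ∈ quotientField (P, Q) := by
  have hQ' := RatFunc.algebraMap_ne_zero hQ
  have hmem : algebraMap F[X] (RatFunc F) P / algebraMap F[X] (RatFunc F) Q ∈
    quotientField (P, Q) := IntermediateField.mem_adjoin_simple_self F _
  have hlin (a b : F) : algebraMap F[X] (RatFunc F) (C a * P + C b * Q) /
      algebraMap F[X] (RatFunc F) Q ∈ quotientField (P, Q) := by
    have : algebraMap F[X] (RatFunc F) (C a * P + C b * Q) / algebraMap F[X] (RatFunc F) Q =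
        algebraMap F (RatFunc F) a * (algebraMap F[X] (RatFunc F) P / algebraMap F[X] (RatFunc F) Q)
          + algebraMap F (RatFunc F) b := by
      rw [RatFunc.algebraMap_eq_C, map_add, map_mul, map_mul, RatFunc.algebraMap_C,
        RatFunc.algebraMap_C]
      field_simp
    rw [this]
    exact add_mem (mul_mem (algebraMap_mem _ _) hmem) (algebraMap_mem _ _)
  rw [← div_div_div_cancel_right₀ hQ']
  exact div_mem (hlin α β) (hlin γ δ)

theorem quotientField_moebius_le {P Q : F[X]} (hQ : Q ≠ 0) (α β γ δ : F) :
    quotientField (C α * P + C β * Q, C γ * P + C δ * Q) ≤ quotientField (P, Q) :=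
  IntermediateField.adjoin_simple_le_iff.mpr (moebius_mem_quotientField hQ α β γ δ)

theorem quotientField_moebius {P Q : F[X]} (hQ : Q ≠ 0) {α β γ δ : F} (hdet : α * δ - β * γ ≠ 0)
    (hQ' : C γ * P + C δ * Q ≠ 0) :
    quotientField (C α * P + C β * Q, C γ * P + C δ * Q) = quotientField (P, Q) := by
  refine le_antisymm (quotientField_moebius_le hQ α β γ δ) ?_
  set Δ := α * δ - β * γ with hΔ
  have h1 : C Δ⁻¹ * (C α * C δ - C β * C γ) = (1 : F[X]) := by
    simp only [← C_mul, ← C_sub, ← hΔ, inv_mul_cancel₀ hdet, C_1]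
  convert quotientField_moebius_le hQ' (Δ⁻¹ * δ) (-(Δ⁻¹ * β)) (-(Δ⁻¹ * γ)) (Δ⁻¹ * α) using 3
  · simp only [C_mul, C_neg]
    linear_combination -P * h1
  · simp only [C_mul, C_neg]
    linear_combination -Q * h1

theorem isCoprime_moebius {P Q : F[X]} (h : IsCoprime P Q) {α β γ δ : F}
    (hdet : α * δ - β * γ ≠ 0) : IsCoprime (C α * P + C β * Q) (C γ * P + C δ * Q) := by
  obtain ⟨u, v, h⟩ := h
  set Δ := α * δ - β * γ with hΔ
  have h1 : C Δ⁻¹ * (C α * C δ - C β * C γ) = (1 : F[X]) := by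
    simp only [← C_mul, ← C_sub, ← hΔ, inv_mul_cancel₀ hdet, C_1]
  refine ⟨C Δ⁻¹ * (u * C δ - v * C γ), C Δ⁻¹ * (v * C α - u * C β), ?_⟩
  linear_combination (u * P + v * Q) * h1 + h

theorem finrank_quotientField {n : ℕ} {x : F[X] × F[X]} (hx : x ∈ normalPairs F n) :
    Module.finrank (quotientField x) (RatFunc F) = n := by
  obtain ⟨⟨⟨hP, hPn⟩, hQn, h⟩, hQ, -⟩ := hx
  rw [mem_degreeLT, degree_eq_natDegree hQ.ne_zero, Nat.cast_lt] at hQn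
  rw [quotientField, RatFunc.finrank_eq_max_natDegree, (num_denom_of_isCoprime hQ h).1,
    (num_denom_of_isCoprime hQ h).2]
  omega

theorem exists_coprime_pair (E : IntermediateField F (RatFunc F)) :
    ∃ P Q : F[X], IsCoprime P Q ∧ Q.Monic ∧ quotientField (P, Q) = E ∧
      max P.natDegree Q.natDegree = Module.finrank E (RatFunc F) := by
  have hE := RatFunc.Luroth.eq_adjoin_generator (E := E)
  set f := RatFunc.Luroth.generator E
  refine ⟨f.num, f.denom, f.isCoprime_num_denom, f.monic_denom, ?_, ?_⟩
  · rw [quotientField, RatFunc.num_div_denom, ← hE]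
  · rw [hE, RatFunc.finrank_eq_max_natDegree]

theorem exists_coprime_pair_degree_lt (E : IntermediateField F (RatFunc F))
    (hE : 1 ≤ Module.finrank E (RatFunc F)) :
    ∃ P Q : F[X], IsCoprime P Q ∧ Q ≠ 0 ∧ quotientField (P, Q) = E ∧
      P.natDegree = Module.finrank E (RatFunc F) ∧
      Q ∈ degreeLT F (Module.finrank E (RatFunc F)) := by
  obtain ⟨P, Q, h, hQ, hPQ, hd⟩ := exists_coprime_pair E
  rcases lt_or_ge Q.natDegree P.natDegree with hlt | hge
  · rw [max_eq_left hlt.le] at hd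
    refine ⟨P, Q, h, hQ.ne_zero, hPQ, hd, ?_⟩
    rwa [mem_degreeLT, degree_eq_natDegree hQ.ne_zero, Nat.cast_lt, ← hd]
  rw [max_eq_right hge] at hd
  set c := P.coeff Q.natDegree with hc
  have hdet : (0 : F) * -c - 1 * 1 ≠ 0 := by simp
  have hcop := isCoprime_moebius h hdet
  have h0 : C 1 * P + C (-c) * Q ≠ 0 := by
    intro h0
    rw [h0, isCoprime_zero_right] at hcop
    have := natDegree_eq_zero_of_isUnit hcop
    simp at this
    omega
  refine ⟨_, _, hcop, h0, (quotientField_moebius hQ.ne_zero hdet h0).trans hPQ, by simpa using hd,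
    ?_⟩
  rw [mem_degreeLT, ← hd, degree_lt_iff_coeff_zero]
  intro k hk
  rcases hk.eq_or_lt with rfl | hk
  · simp [hQ.coeff_natDegree, ← hc]
  · simp [coeff_eq_zero_of_natDegree_lt hk, coeff_eq_zero_of_natDegree_lt (hge.trans_lt hk)]

theorem exists_mem_normalPairs (E : IntermediateField F (RatFunc F))
    (hE : 1 ≤ Module.finrank E (RatFunc F)) :
    ∃ x ∈ normalPairs F (Module.finrank E (RatFunc F)), quotientField x = E := by
  obtain ⟨P, Q, h, hQ, hPQ, hd, hQn⟩ := exists_coprime_pair_degree_lt E hE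
  have hP : P ≠ 0 := by rintro rfl; simp at hd; omega
  have ha : P.leadingCoeff⁻¹ ≠ 0 := inv_ne_zero (leadingCoeff_ne_zero.mpr hP)
  have hb : Q.leadingCoeff⁻¹ ≠ 0 := inv_ne_zero (leadingCoeff_ne_zero.mpr hQ)
  set a := P.leadingCoeff⁻¹ with ha'
  set b := Q.leadingCoeff⁻¹ with hb'
  set n := Module.finrank E (RatFunc F)
  have hbQ : (C b * Q).Monic := by
    rw [mul_comm]; exact monic_mul_leadingCoeff_inv hQ
  have haP : C a * P ∈ monics F n := by
    refine ⟨?_, by rw [natDegree_C_mul ha, hd]⟩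
    rw [mul_comm]; exact monic_mul_leadingCoeff_inv hP
  have hbQn : C b * Q ∈ degreeLT F n := by
    rw [← smul_eq_C_mul]
    exact (degreeLT F n).smul_mem b hQn
  set v := a * P.coeff (C b * Q).natDegree with hv
  have hdet : a * b - -(v * b) * 0 ≠ 0 := by simp [ha, hb]
  have h0 : C 0 * P + C b * Q = C b * Q := by simp
  have h1 : C a * P + C (-(v * b)) * Q = C a * P + C (-v) * (C b * Q) := by
    simp only [C_neg, C_mul]; ring
  have hcop := isCoprime_moebius h hdet
  have hfield := quotientField_moebius (P := P) hQ hdet (by rw [h0]; exact hbQ.ne_zero)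
  rw [h0, h1] at hcop hfield
  have hcoeff : (C a * P + C (-v) * (C b * Q)).coeff (C b * Q).natDegree = 0 := by
    rw [coeff_add, coeff_C_mul, coeff_C_mul (C b * Q), hbQ.coeff_natDegree, hv]
    ring
  have hmem : (C a * P + C (-v) * (C b * Q), C b * Q) ∈ normalPairs F n :=
    ⟨⟨monic_add_C_mul haP hbQn (-v), hbQn, hcop⟩, hbQ, hcoeff⟩
  exact ⟨_, hmem, hfield.trans hPQ⟩

theorem exists_moebius_of_adjoin_eq {f g : RatFunc F} (hf : Transcendental F f)
    (h : IntermediateField.adjoin F {f} = IntermediateField.adjoin F {g}) :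
    ∃ α β γ δ : F, (γ ≠ 0 ∨ δ ≠ 0) ∧
      g * (RatFunc.C γ * f + RatFunc.C δ) = RatFunc.C α * f + RatFunc.C β := by
  let φ := RatFunc.algEquivOfTranscendental f hf
  let χ : RatFunc F →ₐ[F] RatFunc F := (IntermediateField.val _).comp φ.toAlgHom
  have hg : g ∈ IntermediateField.adjoin F {f} := h ▸ IntermediateField.mem_adjoin_simple_self F g
  obtain ⟨u, hu⟩ := φ.surjective ⟨g, hg⟩
  have hχu : χ u = g := congrArg Subtype.val hu
  have hχX : χ RatFunc.X = f := RatFunc.algEquivOfTranscendental_X f hf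
  have htop : IntermediateField.adjoin F {u} = ⊤ := by
    rw [← RatFunc.adjoin_X]
    refine IntermediateField.map_injective χ ?_
    rw [IntermediateField.adjoin_map, IntermediateField.adjoin_map, Set.image_singleton,
      Set.image_singleton, hχu, hχX, h]
  have hrank := RatFunc.finrank_eq_max_natDegree u
  rw [htop, IntermediateField.finrank_top] at hrank
  obtain ⟨hn, hd⟩ := max_le_iff.mp hrank.ge
  have hval : g = aeval f u.num / aeval f u.denom := by
    rw [← hχu]
    exact RatFunc.algEquivOfTranscendental_apply f hf u
  have hd0 : aeval f u.denom ≠ 0 := fun h0 => u.denom_ne_zero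
    ((transcendental_iff.mp hf) _ h0)
  rw [eq_div_iff hd0] at hval
  refine ⟨u.num.coeff 1, u.num.coeff 0, u.denom.coeff 1, u.denom.coeff 0, ?_, ?_⟩
  · by_contra! h0
    apply u.denom_ne_zero
    rw [eq_X_add_C_of_natDegree_le_one hd, h0.1, h0.2]
    simp
  · rw [eq_X_add_C_of_natDegree_le_one hd, eq_X_add_C_of_natDegree_le_one hn] at hval
    simpa [RatFunc.algebraMap_eq_C] using hval

theorem quotientField_injOn (n : ℕ) :
    Set.InjOn (quotientField (F := F)) (normalPairs F n) := by
  rintro ⟨P, Q⟩ ⟨⟨⟨hP, hPn⟩, hQn, h⟩, hQ, hc⟩ ⟨P', Q'⟩ ⟨⟨⟨hP', hPn'⟩, hQn', h'⟩, hQ', hc'⟩ he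
  dsimp only at hP hPn hQn h hQ hc hP' hPn' hQn' h' hQ' hc'
  rw [mem_degreeLT, degree_eq_natDegree hQ.ne_zero, Nat.cast_lt] at hQn
  rw [mem_degreeLT, degree_eq_natDegree hQ'.ne_zero, Nat.cast_lt] at hQn'
  have htr : Transcendental F
      (algebraMap F[X] (RatFunc F) P / algebraMap F[X] (RatFunc F) Q) := by
    refine RatFunc.transcendental_of_ne_C _ fun hC => ?_
    have := (RatFunc.eq_C_iff _).mp hC
    rw [(num_denom_of_isCoprime hQ h).1] at this
    omega
  obtain ⟨α, β, γ, δ, hγδ, hm⟩ := exists_moebius_of_adjoin_eq htr he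
  have hm' : P' * (C γ * P + C δ * Q) = Q' * (C α * P + C β * Q) := by
    apply RatFunc.algebraMap_injective F
    have h1 := RatFunc.algebraMap_ne_zero hQ.ne_zero
    have h2 := RatFunc.algebraMap_ne_zero hQ'.ne_zero
    simp only [map_mul, map_add, RatFunc.algebraMap_C]
    field_simp at hm
    linear_combination hm
  have hγ : γ = 0 := by
    by_contra hγ
    have h1 : (C γ * P + C δ * Q).natDegree = n := by
      rw [natDegree_add_eq_left_of_natDegree_lt, natDegree_C_mul hγ, hPn]
      rw [natDegree_C_mul hγ, hPn]
      exact (natDegree_C_mul_le _ _).trans_lt hQn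
    have h2 : (C α * P + C β * Q).natDegree ≤ n :=
      natDegree_add_le_of_degree_le ((natDegree_C_mul_le _ _).trans hPn.le)
        ((natDegree_C_mul_le _ _).trans hQn.le)
    have h3 : C γ * P + C δ * Q ≠ 0 := by
      intro h0
      rw [h0, natDegree_zero] at h1
      omega
    have h4 := congrArg natDegree hm'
    rw [natDegree_mul hP'.ne_zero h3, h1, hPn'] at h4
    have h5 := natDegree_mul_le (p := Q') (q := C α * P + C β * Q)
    omega
  subst hγ
  replace hδ : δ ≠ 0 := by simpa using hγδ
  have hα : α ≠ 0 := by
    rintro rfl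
    have h1 : P' * C δ = C β * Q' := mul_right_cancel₀ hQ.ne_zero <| by
      simp only [C_0] at hm'
      linear_combination hm'
    have h2 := congrArg natDegree h1
    rw [natDegree_mul_C hδ, hPn'] at h2
    have h3 := natDegree_C_mul_le β Q'
    omega
  have hδu : IsUnit (C δ : F[X]) := isUnit_C.mpr hδ.isUnit
  have hαu : IsUnit (C α : F[X]) := isUnit_C.mpr hα.isUnit
  obtain rfl : Q = Q' := by
    refine eq_of_monic_of_associated hQ hQ' (associated_of_dvd_dvd ?_ ?_)
    · have : Q ∣ (C α * P) * Q' := ⟨P' * C δ - C β * Q', by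
        simp only [C_0] at hm'
        linear_combination -hm'⟩
      exact ((isCoprime_mul_unit_left_left hαu _ _).mpr h).symm.dvd_of_dvd_mul_left this
    · have : Q' ∣ P' * (C δ * Q) := ⟨C α * P + C β * Q, by simpa using hm'⟩
      exact (hδu.dvd_mul_left).mp (h'.symm.dvd_of_dvd_mul_left this)
  have hlin : C δ * P' = C α * P + C β * Q := mul_left_cancel₀ hQ.ne_zero <| by
    simp only [C_0] at hm'
    linear_combination hm'
  have hPc := hP.coeff_natDegree
  have hPc' := hP'.coeff_natDegree
  rw [hPn] at hPc
  rw [hPn'] at hPc'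
  obtain rfl : δ = α := by
    simpa [hPc, hPc', coeff_eq_zero_of_natDegree_lt hQn] using congrArg (fun R => coeff R n) hlin
  obtain rfl : β = 0 := by
    simpa [hc, hc', hQ.coeff_natDegree] using
      (congrArg (fun R => coeff R Q.natDegree) hlin).symm
  have : P = P' := mul_left_cancel₀ (C_ne_zero.mpr hδ) (by simpa using hlin.symm)
  rw [this]

end Subfields

section Twist

variable {F : Type*} [Field F]

/-- The substitution `X ↦ c * X`, normalized to preserve monic polynomials. -/
noncomputable def twist (c : F) (P : F[X]) : F[X] :=
  C (c ^ P.natDegree)⁻¹ * P.comp (C c * X)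

theorem coeff_twist (c : F) (P : F[X]) (k : ℕ) :
    (twist c P).coeff k = (c ^ P.natDegree)⁻¹ * (P.coeff k * c ^ k) := by
  rw [twist, coeff_C_mul, comp_C_mul_X_coeff]

theorem natDegree_twist {c : F} (hc : c ≠ 0) (P : F[X]) :
    (twist c P).natDegree = P.natDegree := by
  rw [twist, natDegree_C_mul (inv_ne_zero (pow_ne_zero _ hc)), natDegree_comp,
    natDegree_C_mul_X _ hc, mul_one]

theorem monic_twist {c : F} (hc : c ≠ 0) {P : F[X]} (hP : P.Monic) : (twist c P).Monic := by
  rw [Monic, leadingCoeff, natDegree_twist hc, coeff_twist, hP.coeff_natDegree, one_mul,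
    inv_mul_cancel₀ (pow_ne_zero _ hc)]

theorem twist_eq_self_iff {c : F} (hc : c ≠ 0) (P : F[X]) :
    twist c P = P ↔ ∀ k, P.coeff k ≠ 0 → k ≡ P.natDegree [MOD orderOf c] := by
  have hc' := pow_ne_zero P.natDegree hc
  have hu (k : ℕ) : k ≡ P.natDegree [MOD orderOf c] ↔ c ^ k = c ^ P.natDegree := by
    have := pow_eq_pow_iff_modEq (x := Units.mk0 c hc) (n := k) (m := P.natDegree)
    rw [← orderOf_units] at this
    rw [← Units.val_mk0 hc, ← this, Units.ext_iff]
    simp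
  rw [Polynomial.ext_iff]
  refine forall_congr' fun k => ?_
  rw [coeff_twist, hu, inv_mul_eq_iff_eq_mul₀ hc', mul_comm _ (P.coeff k)]
  by_cases h : P.coeff k = 0 <;> simp [h]

theorem isCoprime_twist {c : F} (hc : c ≠ 0) {P Q : F[X]} (h : IsCoprime P Q) :
    IsCoprime (twist c P) (twist c Q) := by
  have hu (n : ℕ) : IsUnit (C (c ^ n)⁻¹ : F[X]) :=
    isUnit_C.mpr (inv_ne_zero (pow_ne_zero _ hc)).isUnit
  rw [twist, twist, isCoprime_mul_unit_left_left (hu _), isCoprime_mul_unit_left_right (hu _)]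
  exact h.map (compRingHom (C c * X))

theorem twist_mem_normalPairs {c : F} (hc : c ≠ 0) {n : ℕ} {x : F[X] × F[X]}
    (hx : x ∈ normalPairs F n) : (twist c x.1, twist c x.2) ∈ normalPairs F n := by
  obtain ⟨⟨⟨hP, hPn⟩, hQn, h⟩, hQ, h0⟩ := hx
  rw [mem_degreeLT, degree_eq_natDegree hQ.ne_zero] at hQn
  refine ⟨⟨⟨monic_twist hc hP, (natDegree_twist hc _).trans hPn⟩, ?_, isCoprime_twist hc h⟩,
    monic_twist hc hQ, ?_⟩
  · rwa [mem_degreeLT, degree_eq_natDegree (monic_twist hc hQ).ne_zero, natDegree_twist hc]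
  · dsimp only
    rw [natDegree_twist hc, coeff_twist, h0]
    simp

theorem map_quotientField {c : F} (hc : c ≠ 0) (σ : RatFunc F →ₐ[F] RatFunc F)
    (hσ : σ RatFunc.X = RatFunc.C c * RatFunc.X) {x : F[X] × F[X]} (hx : x.2 ≠ 0) :
    (quotientField x).map σ = quotientField (twist c x.1, twist c x.2) := by
  have hmap (P : F[X]) : σ (algebraMap F[X] (RatFunc F) P) =
      algebraMap F[X] (RatFunc F) (P.comp (C c * X)) := by
    rw [← RatFunc.aeval_X_left_eq_algebraMap, ← RatFunc.aeval_X_left_eq_algebraMap, aeval_comp,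
      ← aeval_algHom_apply, hσ]
    simp
  have hne : x.2.comp (C c * X) ≠ 0 := by
    intro h
    have h1 : (twist c x.2).coeff x.2.natDegree = 0 := by simp [twist, h]
    rw [coeff_twist] at h1
    simp [hc, hx] at h1
  have hdet : (c ^ x.1.natDegree)⁻¹ * (c ^ x.2.natDegree)⁻¹ - 0 * 0 ≠ 0 := by simp [hc]
  have h := quotientField_moebius (P := x.1.comp (C c * X)) hne hdet
    (by simpa [hc] using hne)
  simp only [C_0, zero_mul, add_zero, zero_add] at h
  rw [twist, twist, h, quotientField, quotientField, IntermediateField.adjoin_map,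
    Set.image_singleton, map_div₀, hmap, hmap]

/-- The exponents occurring in `P` are congruent to its degree modulo `d`. -/
def IsLacunary (d : ℕ) (P : F[X]) : Prop :=
  ∀ k, P.coeff k ≠ 0 → k ≡ P.natDegree [MOD d]

theorem card_fixed_eq_ncard {c : F} (hc : c ≠ 0) {n : ℕ} (hn : 1 ≤ n)
    (σ : RatFunc F →ₐ[F] RatFunc F) (hσ : σ RatFunc.X = RatFunc.C c * RatFunc.X) :
    Nat.card {E : IntermediateField F (RatFunc F) //
        Module.finrank E (RatFunc F) = n ∧ E.map σ = E} =
      {x ∈ normalPairs F n |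
        IsLacunary (orderOf c) x.1 ∧ IsLacunary (orderOf c) x.2}.ncard := by
  have hfix {x : F[X] × F[X]} (hx : x ∈ normalPairs F n) :
      (quotientField x).map σ = quotientField x ↔
        IsLacunary (orderOf c) x.1 ∧ IsLacunary (orderOf c) x.2 := by
    rw [map_quotientField hc σ hσ hx.2.1.ne_zero,
      (quotientField_injOn n).eq_iff (twist_mem_normalPairs hc hx) hx, Prod.ext_iff,
      twist_eq_self_iff hc, twist_eq_self_iff hc]
    rfl
  rw [← Set.InjOn.ncard_image ((quotientField_injOn n).mono (Set.sep_subset _ _)),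
    ← Nat.card_coe_set_eq]
  congr 1
  refine congrArg (fun s : Set _ => (s : Type _)) (Set.ext fun E => ?_)
  constructor
  · rintro ⟨rfl, hE⟩
    obtain ⟨x, hx, rfl⟩ := exists_mem_normalPairs E hn
    exact ⟨x, ⟨hx, (hfix hx).mp hE⟩, rfl⟩
  · rintro ⟨x, ⟨hx, h⟩, rfl⟩
    exact ⟨finrank_quotientField hx, (hfix hx).mpr h⟩

end Twist

section Lacunary

variable {F : Type*} [Field F] {d : ℕ}

theorem isLacunary_X_pow_mul_expand (hd : 0 < d) (i : ℕ) {P : F[X]} (hP : P.Monic) :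
    IsLacunary d (X ^ i * expand F d P) := by
  have hE : (expand F d P).Monic := (monic_expand_iff hd).mpr hP
  intro k hk
  rw [(monic_X_pow i).natDegree_mul hE, natDegree_X_pow, natDegree_expand]
  rw [coeff_X_pow_mul'] at hk
  split_ifs at hk with hik
  · rw [coeff_expand hd] at hk
    split_ifs at hk with hdk
    · obtain ⟨l, hl⟩ := hdk
      obtain rfl : k = i + d * l := by omega
      exact Nat.ModEq.add_left i (by simp [Nat.ModEq])
    · exact absurd rfl hk
  · exact absurd rfl hk

theorem natDegree_X_pow_mul_expand (hd : 0 < d) (i : ℕ) {P : F[X]} (hP : P.Monic) :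
    (X ^ i * expand F d P).natDegree = i + d * P.natDegree := by
  rw [(monic_X_pow i).natDegree_mul ((monic_expand_iff hd).mpr hP), natDegree_X_pow,
    natDegree_expand, mul_comm d]

theorem monic_X_pow_mul_expand (hd : 0 < d) (i : ℕ) {P : F[X]} (hP : P.Monic) :
    (X ^ i * expand F d P).Monic :=
  (monic_X_pow i).mul ((monic_expand_iff hd).mpr hP)

theorem exists_eq_X_pow_mul_expand (hd : 0 < d) {P : F[X]} (hP : P.Monic) (h : IsLacunary d P) :
    ∃ R : F[X], R.Monic ∧ P = X ^ (P.natDegree % d) * expand F d R := by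
  set i := P.natDegree % d with hi
  have hid : i < d := Nat.mod_lt _ hd
  have hmod {k : ℕ} (hk : P.coeff k ≠ 0) : k % d = i := h k hk
  obtain ⟨S, hS⟩ : X ^ i ∣ P := by
    rw [X_pow_dvd_iff]
    intro k hk
    by_contra h0
    have := hmod h0
    rw [Nat.mod_eq_of_lt (hk.trans hid)] at this
    omega
  have hE : expand F d (contract d S) = S := by
    ext k
    rw [coeff_expand hd]
    split_ifs with hk
    · rw [coeff_contract hd.ne', Nat.div_mul_cancel hk]
    · by_contra h0
      rw [← coeff_X_pow_mul S i k, ← hS] at h0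
      have h1 : k + i ≡ 0 + i [MOD d] := by
        have := hmod (Ne.symm h0)
        rw [Nat.ModEq, this, zero_add, Nat.mod_eq_of_lt hid]
      exact hk ((Nat.modEq_zero_iff_dvd).mp (Nat.ModEq.add_right_cancel' i h1))
  refine ⟨contract d S, ?_, by rw [hE, ← hS]⟩
  rw [← monic_expand_iff hd, hE]
  exact (monic_X_pow i).of_mul_monic_left (hS ▸ hP)

theorem X_pow_mul_expand_inj (hd : 0 < d) {i j : ℕ} (hi : i < d) (hj : j < d) {P Q : F[X]}
    (hP : P.Monic) (hQ : Q.Monic) (h : X ^ i * expand F d P = X ^ j * expand F d Q) :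
    i = j ∧ P = Q := by
  obtain rfl : i = j := by
    have := congrArg (fun R => natDegree R % d) h
    simpa [natDegree_X_pow_mul_expand hd _ hP, natDegree_X_pow_mul_expand hd _ hQ,
      Nat.mod_eq_of_lt hi, Nat.mod_eq_of_lt hj] using this
  exact ⟨rfl, expand_injective hd (mul_left_cancel₀ (pow_ne_zero _ X_ne_zero) h)⟩

theorem isCoprime_X_pow_mul_expand_left (hd : 0 < d) {i : ℕ} (hi : i ≠ 0) {P Q : F[X]} :
    IsCoprime (X ^ i * expand F d P) (expand F d Q) ↔ Q.coeff 0 ≠ 0 ∧ IsCoprime P Q := by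
  rw [IsCoprime.mul_left_iff, IsCoprime.pow_left_iff (Nat.pos_of_ne_zero hi),
    isCoprime_X_left_iff, isCoprime_expand hd.ne', coeff_expand hd]
  simp

theorem not_isCoprime_X_pow_mul {i j : ℕ} (hi : i ≠ 0) (hj : j ≠ 0) (P Q : F[X]) :
    ¬ IsCoprime (X ^ i * P) (X ^ j * Q) := fun h =>
  not_isUnit_X (h.isUnit_of_dvd' ((dvd_pow_self X hi).mul_right P)
    ((dvd_pow_self X hj).mul_right Q))

theorem mem_degreeLT_of_monic {k : ℕ} {Q : F[X]} (hQ : Q.Monic) :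
    Q ∈ degreeLT F k ↔ Q.natDegree < k := by
  rw [mem_degreeLT, degree_eq_natDegree hQ.ne_zero, Nat.cast_lt]

theorem lacunary_normalPairs_of_not_dvd (hd : 0 < d) {n : ℕ} (hdn : ¬ d ∣ n) :
    {x ∈ normalPairs F n | IsLacunary d x.1 ∧ IsLacunary d x.2} =
      (fun x : F[X] × F[X] => (X ^ (n % d) * expand F d x.1, expand F d x.2)) ''
        {x ∈ coprimePairs F (n / d) (n / d + 1) | x.2.coeff 0 ≠ 0 ∧ x.2.Monic} := by
  have hi : n % d ≠ 0 := fun h => hdn (Nat.dvd_of_mod_eq_zero h)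
  have hn := Nat.mod_add_div n d
  have hid := Nat.mod_lt n hd
  ext ⟨P, Q⟩
  constructor
  · rintro ⟨⟨⟨⟨hP, hPn⟩, hQn, h⟩, hQ, -⟩, hlP, hlQ⟩
    dsimp only at hP hPn hQn h hQ hlP hlQ
    obtain ⟨P', hP', hPe⟩ := exists_eq_X_pow_mul_expand hd hP hlP
    obtain ⟨Q', hQ', hQe⟩ := exists_eq_X_pow_mul_expand hd hQ hlQ
    rw [hPn] at hPe
    have hj : Q.natDegree % d = 0 := by
      by_contra hj
      rw [hPe, hQe] at h
      exact not_isCoprime_X_pow_mul hi hj _ _ h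
    rw [hj, pow_zero, one_mul] at hQe
    subst hPe hQe
    rw [isCoprime_X_pow_mul_expand_left hd hi] at h
    rw [natDegree_X_pow_mul_expand hd _ hP'] at hPn
    rw [mem_degreeLT_of_monic hQ, natDegree_expand] at hQn
    refine ⟨(P', Q'), ⟨⟨⟨hP', ?_⟩, ?_, h.2⟩, h.1, hQ'⟩, rfl⟩
    · exact Nat.eq_of_mul_eq_mul_left hd (by dsimp only; omega)
    · rw [mem_degreeLT_of_monic hQ', Nat.lt_succ_iff, Nat.le_div_iff_mul_le hd]
      exact hQn.le
  · rintro ⟨⟨P, Q⟩, ⟨⟨⟨hP, hPn⟩, hQn, h⟩, h0, hQ⟩, he⟩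
    obtain ⟨rfl, rfl⟩ := Prod.mk.inj he
    dsimp only at hP hPn hQn h h0 hQ
    have hdeg := natDegree_X_pow_mul_expand hd (n % d) hP
    rw [hPn, hn] at hdeg
    have hEQ := (monic_expand_iff hd).mpr hQ
    have hlP := isLacunary_X_pow_mul_expand hd (n % d) hP
    rw [mem_degreeLT_of_monic hQ, Nat.lt_succ_iff, Nat.le_div_iff_mul_le hd] at hQn
    refine ⟨⟨⟨⟨monic_X_pow_mul_expand hd _ hP, hdeg⟩, ?_,
      (isCoprime_X_pow_mul_expand_left hd hi).mpr ⟨h0, h⟩⟩, hEQ, ?_⟩, hlP, ?_⟩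
    · rw [mem_degreeLT_of_monic hEQ, natDegree_expand]
      refine lt_of_le_of_ne hQn fun h => hdn ⟨Q.natDegree, ?_⟩
      rw [mul_comm, h]
    · by_contra hc
      have := hlP _ hc
      rw [hdeg, natDegree_expand, Nat.ModEq, Nat.mul_mod_left] at this
      exact hi this.symm
    · simpa using isLacunary_X_pow_mul_expand hd 0 hQ

theorem lacunary_normalPairs_of_dvd (hd : 0 < d) (m : ℕ) :
    {x ∈ normalPairs F (d * m) | IsLacunary d x.1 ∧ IsLacunary d x.2} =
      (fun x : F[X] × F[X] => (expand F d x.1, expand F d x.2)) '' normalPairs F m ∪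
      (fun x : ℕ × F[X] × F[X] => (expand F d x.2.1, X ^ x.1 * expand F d x.2.2)) ''
        (Set.Ico 1 d ×ˢ {x ∈ coprimePairs F m m | x.1.coeff 0 ≠ 0 ∧ x.2.Monic}) := by
  ext ⟨P, Q⟩
  constructor
  · rintro ⟨⟨⟨⟨hP, hPn⟩, hQn, h⟩, hQ, hc⟩, hlP, hlQ⟩
    dsimp only at hP hPn hQn h hQ hlP hlQ hc
    obtain ⟨P', hP', hPe⟩ := exists_eq_X_pow_mul_expand hd hP hlP
    obtain ⟨Q', hQ', hQe⟩ := exists_eq_X_pow_mul_expand hd hQ hlQ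
    rw [hPn, Nat.mul_mod_right, pow_zero, one_mul] at hPe
    have hj := Nat.mod_lt Q.natDegree hd
    set j := Q.natDegree % d
    clear_value j
    subst hPe hQe
    rw [natDegree_expand, mul_comm] at hPn
    have hP'n : P'.natDegree = m := Nat.eq_of_mul_eq_mul_left hd hPn
    rw [mem_degreeLT_of_monic hQ, natDegree_X_pow_mul_expand hd _ hQ'] at hQn
    have hQ'n : Q' ∈ degreeLT F m := by
      rw [mem_degreeLT_of_monic hQ']
      exact Nat.lt_of_mul_lt_mul_left ((Nat.le_add_left _ _).trans_lt hQn)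
    rcases Nat.eq_zero_or_pos j with rfl | hj0
    · rw [pow_zero, one_mul] at hc h ⊢
      rw [natDegree_expand, coeff_expand_mul hd] at hc
      exact Or.inl ⟨(P', Q'), ⟨⟨⟨hP', hP'n⟩, hQ'n, (isCoprime_expand hd.ne').mp h⟩, hQ', hc⟩, rfl⟩
    · rw [isCoprime_comm, isCoprime_X_pow_mul_expand_left hd hj0.ne'] at h
      exact Or.inr ⟨(j, P', Q'), ⟨⟨hj0, hj⟩, ⟨⟨hP', hP'n⟩, hQ'n, h.2.symm⟩, h.1, hQ'⟩, rfl⟩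
  · rintro (⟨⟨P, Q⟩, ⟨⟨⟨hP, hPn⟩, hQn, h⟩, hQ, hc⟩, he⟩ |
      ⟨⟨j, P, Q⟩, ⟨⟨hj0, hj⟩, ⟨⟨hP, hPn⟩, hQn, h⟩, h0, hQ⟩, he⟩)
    all_goals
      obtain ⟨rfl, rfl⟩ := Prod.mk.inj he
      dsimp only at hP hPn hQn h hQ
      rw [mem_degreeLT_of_monic hQ] at hQn
      have hlP := isLacunary_X_pow_mul_expand hd 0 hP
      rw [pow_zero, one_mul] at hlP
      have hEP := (monic_expand_iff hd).mpr hP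
      have hdeg : (expand F d P).natDegree = d * m := by rw [natDegree_expand, hPn, mul_comm]
    · have hlQ := isLacunary_X_pow_mul_expand hd 0 hQ
      rw [pow_zero, one_mul] at hlQ
      have hEQ := (monic_expand_iff hd).mpr hQ
      refine ⟨⟨⟨⟨hEP, hdeg⟩, ?_, (isCoprime_expand hd.ne').mpr h⟩, hEQ, ?_⟩, hlP, hlQ⟩
      · rw [mem_degreeLT_of_monic hEQ, natDegree_expand, mul_comm]
        exact Nat.mul_lt_mul_of_pos_left hQn hd
      · dsimp only
        rw [natDegree_expand, coeff_expand_mul hd]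
        exact hc
    · dsimp only at hj0 hj h0
      have hEQ := monic_X_pow_mul_expand hd j hQ
      have hdegQ := natDegree_X_pow_mul_expand hd j hQ
      have hcop : IsCoprime (expand F d P) (X ^ j * expand F d Q) :=
        ((isCoprime_X_pow_mul_expand_left hd (by omega)).mpr ⟨h0, h.symm⟩).symm
      refine ⟨⟨⟨⟨hEP, hdeg⟩, ?_, hcop⟩, hEQ, ?_⟩, hlP, isLacunary_X_pow_mul_expand hd j hQ⟩
      · rw [mem_degreeLT_of_monic hEQ, hdegQ]
        have := Nat.mul_le_mul_left d (Nat.succ_le_of_lt hQn)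
        rw [Nat.mul_succ] at this
        omega
      · by_contra hc
        have := hlP _ hc
        rw [hdeg, hdegQ, Nat.ModEq, Nat.mul_mod_right, Nat.add_mul_mod_self_left,
          Nat.mod_eq_of_lt hj] at this
        omega

variable [Fintype F]

theorem ncard_lacunary_normalPairs_of_not_dvd (hd : 0 < d) {n : ℕ} (hdn : ¬ d ∣ n) :
    ({x ∈ normalPairs F n | IsLacunary d x.1 ∧ IsLacunary d x.2}.ncard : ℚ) =
      ((Fintype.card F : ℚ) ^ (2 * (n / d) + 1) + 1) / ((Fintype.card F : ℚ) + 1) := by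
  rw [lacunary_normalPairs_of_not_dvd hd hdn, Set.InjOn.ncard_image, eq_div_iff (by positivity),
    mul_comm, ncard_coprimePairs_monic_snd_coeff_zero_ne_zero]
  rintro ⟨P, Q⟩ - ⟨P', Q'⟩ - he
  simpa [X_ne_zero, expand_inj hd] using he

theorem ncard_lacunary_normalPairs_of_dvd (hd : 0 < d) (m : ℕ) :
    ({x ∈ normalPairs F (d * (m + 1)) | IsLacunary d x.1 ∧ IsLacunary d x.2}.ncard : ℚ) =
      (Fintype.card F : ℚ) ^ (2 * m) +
        ((d : ℚ) - 1) * ((Fintype.card F : ℚ) ^ (2 * (m + 1)) - 1) /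
          ((Fintype.card F : ℚ) + 1) := by
  have hfin := finite_coprimePairs (F := F) (m + 1) (m + 1)
  have hfin' : (normalPairs F (m + 1)).Finite := hfin.subset (Set.sep_subset _ _)
  rw [lacunary_normalPairs_of_dvd hd, Set.ncard_union_eq ?_ (hfin'.image _)
      (((Set.finite_Ico 1 d).prod (hfin.subset (Set.sep_subset _ _))).image _),
    Set.InjOn.ncard_image, Set.InjOn.ncard_image, Set.ncard_prod, Nat.cast_add, ncard_normalPairs_succ, mul_div_assoc,
    ← ncard_coprimePairs_monic_fst_coeff_zero_ne_zero, mul_div_cancel_left₀ _ (by positivity),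
    Nat.cast_mul, ← Finset.coe_Ico, Set.ncard_coe_finset, Nat.card_Ico, Nat.cast_pred hd]
  · rintro ⟨i, P, Q⟩ ⟨hi, -, -, hQ⟩ ⟨j, P', Q'⟩ ⟨hj, -, -, hQ'⟩ he
    simp only [Prod.mk.injEq] at he ⊢
    obtain ⟨rfl, rfl⟩ := X_pow_mul_expand_inj hd hi.2 hj.2 hQ hQ' he.2
    exact ⟨rfl, expand_injective hd he.1, rfl⟩
  · rintro ⟨P, Q⟩ - ⟨P', Q'⟩ - he
    simpa [expand_inj hd] using he
  · rw [Set.disjoint_left]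
    rintro _ ⟨⟨P, Q⟩, ⟨-, hQ, -⟩, rfl⟩ ⟨⟨j, P', Q'⟩, ⟨hj, -, -, hQ'⟩, he⟩
    simp only [Prod.mk.injEq] at he
    have := (X_pow_mul_expand_inj hd hj.2 hd hQ' hQ (by simpa using he.2)).1
    have := hj.1
    omega

end Lacunary

/-- Theorem 3.2: the number of intermediate fields of `F_q(X)/F_q` of codegree `n`
fixed by the automorphism `X ↦ (a/b)·X`, where `a ≠ b` are nonzero and
`d` is the multiplicative order of `a/b`. -/
theorem fix_diagonal (q n : ℕ) (hq : IsPrimePow q) (hn : 1 ≤ n)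
    (F : Type*) [Field F] [Fintype F] (hF : Fintype.card F = q)
    (a b : F) (ha : a ≠ 0) (hb : b ≠ 0) (hab : a ≠ b)
    (d : ℕ) (hd : d = orderOf (a / b))
    (σ : RatFunc F ≃ₐ[F] RatFunc F)
    (hσ : σ RatFunc.X = RatFunc.C (a / b) * RatFunc.X) :
    (Nat.card {E : IntermediateField F (RatFunc F) //
        Module.finrank E (RatFunc F) = n ∧ E.map σ.toAlgHom = E} : ℚ) =
      if d ∣ n then
        (q : ℚ) ^ (2 * (n / d) - 2) +
          ((d : ℚ) - 1) * ((q : ℚ) ^ (2 * (n / d)) - 1) / ((q : ℚ) + 1)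
      else
        ((q : ℚ) ^ (2 * (n / d) + 1) + 1) / ((q : ℚ) + 1) := by
  have hc : a / b ≠ 0 := div_ne_zero ha hb
  have hd0 : 0 < d := by
    rw [hd, ← Units.val_mk0 hc, orderOf_units]
    exact orderOf_pos _
  rw [card_fixed_eq_ncard hc hn σ.toAlgHom hσ, ← hd, ← hF]
  split_ifs with hdn
  · obtain ⟨m, rfl⟩ := hdn
    obtain ⟨m, rfl⟩ := Nat.exists_eq_succ_of_ne_zero (n := m) (by rintro rfl; simp at hn)
    rw [Nat.mul_div_cancel_left _ hd0]
    exact ncard_lacunary_normalPairs_of_dvd hd0 m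
  · exact ncard_lacunary_normalPairs_of_not_dvd hd0 hdn
end
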